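/- arXiv:2006.09095 — 4 statements merged into one kernel-verified Lean document; each statement's English description precedes it below -/
import Mathlib

section
/- Let 𝓕 be a semigroup of entire functions (a family of entire functions closed under composition, with D = ℂ) such that E(𝓕) ≠ ∅, and let z ∈ J(𝓕) \ E(𝓕). Then J(𝓕) equals the closure of the backward orbit O⁻(z), i.e. J(𝓕) = cl(O⁻(z)). -/
open Filter Topology Set

/-- Locally uniform divergence to `∞` on the set `s`: on every compact subset of `s`,
the moduli eventually exceed every bound, uniformly. -/
def TendstoLocallyUniformlyOnInfty (F : ℕ → ℂ → ℂ) (s : Set ℂ) : Prop :=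
  ∀ K ⊆ s, IsCompact K → ∀ M : ℝ, ∀ᶠ n in Filter.atTop, ∀ z ∈ K, M ≤ ‖F n z‖

/-- The family `𝓕` of functions holomorphic on `D` is normal at `z₀ ∈ D`: there is a
neighborhood `N ⊆ D` of `z₀` on which every sequence from `𝓕` has a subsequence converging
locally uniformly either to a holomorphic function or to `∞`. -/
def NormalAt (D : Set ℂ) (𝓕 : Set (ℂ → ℂ)) (z₀ : ℂ) : Prop :=
  ∃ N, N ⊆ D ∧ N ∈ 𝓝 z₀ ∧ ∀ f : ℕ → ℂ → ℂ, (∀ n, f n ∈ 𝓕) →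
    ∃ φ : ℕ → ℕ, StrictMono φ ∧
      ((∃ g : ℂ → ℂ, DifferentiableOn ℂ g N ∧
          TendstoLocallyUniformlyOn (fun n => f (φ n)) g Filter.atTop N) ∨
        TendstoLocallyUniformlyOnInfty (fun n => f (φ n)) N)

/-- The Fatou like set of `𝓕` on `D`: points of `D` where `𝓕` is normal. -/
def FatouSet (D : Set ℂ) (𝓕 : Set (ℂ → ℂ)) : Set ℂ := {z | z ∈ D ∧ NormalAt D 𝓕 z}

/-- The Julia like set of `𝓕` on `D`. -/
def JuliaSet (D : Set ℂ) (𝓕 : Set (ℂ → ℂ)) : Set ℂ := D \ FatouSet D 𝓕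

/-- The backward orbit of `z` with respect to `𝓕`. -/
def BackwardOrbit (D : Set ℂ) (𝓕 : Set (ℂ → ℂ)) (z : ℂ) : Set ℂ :=
  {w | w ∈ D ∧ ∃ f ∈ 𝓕, f w = z}

/-- The exceptional set of `𝓕`: points with finite backward orbit. -/
def ExceptionalSet (D : Set ℂ) (𝓕 : Set (ℂ → ℂ)) : Set ℂ :=
  {z | (BackwardOrbit D 𝓕 z).Finite}

/-- The escaping like set `I(𝓕)`: points `z ∈ D` such that `f n z → ∞` for every
infinite (i.e. injective) sequence `f` in `𝓕`. -/
def EscapingSet (D : Set ℂ) (𝓕 : Set (ℂ → ℂ)) : Set ℂ :=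
  {z | z ∈ D ∧ ∀ f : ℕ → ℂ → ℂ, (∀ n, f n ∈ 𝓕) → Function.Injective f →
    Filter.Tendsto (fun n => ‖f n z‖) Filter.atTop Filter.atTop}

/-- The generalized escaping like set `U(𝓕)`: points `z ∈ D` such that `f n z → ∞` for some
sequence `f` in `𝓕`. -/
def GenEscapingSet (D : Set ℂ) (𝓕 : Set (ℂ → ℂ)) : Set ℂ :=
  {z | z ∈ D ∧ ∃ f : ℕ → ℂ → ℂ, (∀ n, f n ∈ 𝓕) ∧
    Filter.Tendsto (fun n => ‖f n z‖) Filter.atTop Filter.atTop}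

/-- A transcendental entire function: entire and not a polynomial. -/
def TranscendentalEntire (f : ℂ → ℂ) : Prop :=
  Differentiable ℂ f ∧ ¬ ∃ p : Polynomial ℂ, ∀ z, f z = p.eval z

/-- Boundary of `A` relative to `D`; for `D` open and `A ⊆ D` this coincides with the
boundary of `A` in the subspace topology of `D`. -/
def relBoundary (D A : Set ℂ) : Set ℂ := D ∩ frontier A

/-- Closure of `A` in `D`; for `D` open and `A ⊆ D` this coincides with the closure of `A`
in the subspace topology of `D`. -/
def relClosure (D A : Set ℂ) : Set ℂ := D ∩ closure A

lemma aux_log {f : ℂ → ℂ} {c : ℂ} {R : ℝ} (hR : 0 < R)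
    (hf : DifferentiableOn ℂ f (Metric.ball c R)) (h0 : ∀ z ∈ Metric.ball c R, f z ≠ 0) :
    ∃ L : ℂ → ℂ, DifferentiableOn ℂ L (Metric.ball c R) ∧
      ∀ z ∈ Metric.ball c R, Complex.exp (L z) = f z := by
  have hd : DifferentiableOn ℂ (fun z => deriv f z / f z) (Metric.ball c R) :=
    (hf.deriv Metric.isOpen_ball).div hf h0
  obtain ⟨P, hP⟩ := hd.isExactOn_ball
  have hcc : c ∈ Metric.ball c R := Metric.mem_ball_self hR
  have key : ∀ z ∈ Metric.ball c R,
      HasDerivAt (fun z => Complex.exp (-P z) * f z) 0 z := by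
    intro z hz
    have h1 := (hP z hz).neg.cexp
    have h2 := (hf.differentiableAt (Metric.isOpen_ball.mem_nhds hz)).hasDerivAt
    have h3 := h1.mul h2
    have e : deriv f z / f z * f z = deriv f z := div_mul_cancel₀ _ (h0 z hz)
    have e2 : Complex.exp (-P z) * -(deriv f z / f z) * f z + Complex.exp (-P z) * deriv f z
        = 0 := by linear_combination -Complex.exp (-P z) * e
    exact HasDerivAt.congr_deriv h3 e2
  have hconst : ∀ z ∈ Metric.ball c R,
      Complex.exp (-P z) * f z = Complex.exp (-P c) * f c := by
    intro z hz
    exact Metric.isOpen_ball.is_const_of_deriv_eq_zero (convex_ball c R).isPreconnected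
      (fun w hw => (key w hw).differentiableAt.differentiableWithinAt)
      (fun w hw => (key w hw).deriv) hz hcc
  have hne : Complex.exp (-P c) * f c ≠ 0 := mul_ne_zero (Complex.exp_ne_zero _) (h0 c hcc)
  refine ⟨fun z => P z + Complex.log (Complex.exp (-P c) * f c), ?_, ?_⟩
  · exact fun z hz => ((hP z hz).differentiableAt.add_const _).differentiableWithinAt
  · intro z hz
    rw [Complex.exp_add, Complex.exp_log hne, ← hconst z hz, ← mul_assoc, ← Complex.exp_add]
    simp

lemma aux_norm_le_of_cos {v : ℂ} (h : |v.re| ≤ Real.pi) : ‖v‖ ≤ Real.pi + ‖Complex.cos v‖ := by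
  have h1 : |v.im| ≤ ‖Complex.cos v‖ := by
    have hs : |v.im| ≤ Real.sinh |v.im| := Real.self_le_sinh_iff.2 (abs_nonneg _)
    refine hs.trans ?_
    rw [← Real.abs_sinh]
    refine abs_le_of_sq_le_sq ?_ (norm_nonneg _)
    rw [← Complex.normSq_eq_norm_sq, Complex.normSq_apply]
    have e1 := Real.sin_sq_add_cos_sq v.re
    have e2 := Real.cosh_sq v.im
    have e3 : Complex.cos v = ((Real.cos v.re * Real.cosh v.im : ℝ) : ℂ)
        - ((Real.sin v.re * Real.sinh v.im : ℝ) : ℂ) * Complex.I := by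
      rw [Complex.cos_eq]; push_cast; rfl
    have e4 : (Complex.cos v).re = Real.cos v.re * Real.cosh v.im := by
      rw [e3, Complex.sub_re, Complex.re_ofReal_mul, Complex.ofReal_re]; simp
    have e5 : (Complex.cos v).im = -(Real.sin v.re * Real.sinh v.im) := by
      rw [e3, Complex.sub_im, Complex.im_ofReal_mul, Complex.ofReal_im]; simp
    rw [e4, e5]
    have e6 : Real.cos v.re * Real.cosh v.im * (Real.cos v.re * Real.cosh v.im) +
        -(Real.sin v.re * Real.sinh v.im) * -(Real.sin v.re * Real.sinh v.im)
        = Real.sinh v.im ^ 2 + Real.cos v.re ^ 2 := by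
      linear_combination Real.cos v.re ^ 2 * e2 + Real.sinh v.im ^ 2 * e1
    rw [e6]
    nlinarith [sq_nonneg (Real.cos v.re)]
  calc ‖v‖ ≤ |v.re| + |v.im| := Complex.norm_le_abs_re_add_abs_im v
    _ ≤ _ := by linarith

lemma aux_arccos {h : ℂ → ℂ} {c : ℂ} {R : ℝ} (hR : 0 < R)
    (hf : DifferentiableOn ℂ h (Metric.ball c R)) (h1 : ∀ z ∈ Metric.ball c R, h z ≠ 1)
    (h2 : ∀ z ∈ Metric.ball c R, h z ≠ -1) :
    ∃ H : ℂ → ℂ, DifferentiableOn ℂ H (Metric.ball c R) ∧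
      (∀ z ∈ Metric.ball c R, Complex.cos (H z) = h z) ∧ ‖H c‖ ≤ Real.pi + ‖h c‖ := by
  obtain ⟨L, hL, hLe⟩ := aux_log (f := fun z => 1 - h z ^ 2) hR (by fun_prop) (by
    intro z hz hh
    have : (1 - h z) * (h z - (-1)) = 0 := by linear_combination hh
    rcases mul_eq_zero.1 this with h' | h'
    · exact h1 z hz (sub_eq_zero.1 h').symm
    · exact h2 z hz (sub_eq_zero.1 h'))
  have hq : ∀ z ∈ Metric.ball c R, Complex.exp (L z / 2) ^ 2 = 1 - h z ^ 2 := by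
    intro z hz
    rw [← hLe z hz, ← Complex.exp_nat_mul]; congr 1; push_cast; ring
  have hprod : ∀ z ∈ Metric.ball c R, (h z + Complex.I * Complex.exp (L z / 2)) *
      (h z - Complex.I * Complex.exp (L z / 2)) = 1 := by
    intro z hz
    linear_combination hq z hz - Complex.exp (L z / 2) ^ 2 * Complex.I_sq
  obtain ⟨G, hG, hGe⟩ := aux_log (f := fun z => h z + Complex.I * Complex.exp (L z / 2)) hR
    (by fun_prop) (fun z hz => left_ne_zero_of_mul_eq_one (hprod z hz))
  have hcos : ∀ z ∈ Metric.ball c R, Complex.cos (-Complex.I * G z) = h z := by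
    intro z hz
    have e1 : Complex.exp (-G z) = h z - Complex.I * Complex.exp (L z / 2) := by
      rw [Complex.exp_neg, hGe z hz]
      exact inv_eq_of_mul_eq_one_right (hprod z hz)
    rw [Complex.cos]
    have a1 : -Complex.I * G z * Complex.I = G z := by linear_combination -G z * Complex.I_sq
    have a2 : -(-Complex.I * G z) * Complex.I = - G z := by linear_combination G z * Complex.I_sq
    rw [a1, a2, e1, hGe z hz]; ring
  set k : ℤ := round ((-Complex.I * G c).re / (2 * Real.pi)) with hk
  refine ⟨fun z => -Complex.I * G z - k * (2 * Real.pi), by fun_prop, ?_, ?_⟩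
  · intro z hz
    simp only
    rw [Complex.cos_sub_int_mul_two_pi, hcos z hz]
  · have hcc : c ∈ Metric.ball c R := Metric.mem_ball_self hR
    have := aux_norm_le_of_cos (v := -Complex.I * G c - k * (2 * Real.pi)) (by
      have hr := abs_sub_round ((-Complex.I * G c).re / (2 * Real.pi))
      rw [← hk] at hr
      have hp := Real.pi_pos
      have e : (-Complex.I * G c - k * (2 * Real.pi)).re =
        ((-Complex.I * G c).re / (2 * Real.pi) - k) * (2 * Real.pi) := by
        have : ((k:ℂ) * (2 * Real.pi)).re = k * (2 * Real.pi) := by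
          have : ((k:ℂ) * (2 * Real.pi)) = ((k * (2 * Real.pi) : ℝ) : ℂ) := by push_cast; rfl
          rw [this, Complex.ofReal_re]
        rw [Complex.sub_re, this]; field_simp
      rw [e, abs_mul, abs_of_pos (by positivity : 0 < 2 * Real.pi)]
      nlinarith)
    rwa [Complex.cos_sub_int_mul_two_pi, hcos c hcc] at this

lemma aux_local {g : ℂ → ℂ} {p : ℂ} {ρ : ℝ} (hρ : 0 < ρ)
    (hg : DifferentiableOn ℂ g (Metric.ball p ρ)) (h0 : deriv g p ≠ 0)
    (hb : ∀ z ∈ Metric.ball p ρ, ‖deriv g z‖ ≤ 2 * ‖deriv g p‖) :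
    Metric.ball (g p) (ρ * ‖deriv g p‖ / 24) ⊆ g '' Metric.ball p ρ := by
  set A := ‖deriv g p‖ with hA
  have hA0 : 0 < A := norm_pos_iff.2 h0
  have hsub : Metric.closedBall p (ρ/6) ⊆ Metric.ball p ρ :=
    Metric.closedBall_subset_ball (by linarith)
  have hpp : p ∈ Metric.ball p ρ := Metric.mem_ball_self hρ
  have hS : ∀ z ∈ Metric.ball p ρ, ‖deriv g z - deriv g p‖ ≤ 3 * A / ρ * ‖z - p‖ := by
    intro z hz
    have := Complex.dist_le_div_mul_dist_of_mapsTo_ball (f := deriv g) (R₂ := 3 * A)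
      (hg.deriv Metric.isOpen_ball) (by
        intro w hw
        rw [mem_closedBall_iff_norm]
        calc _ ≤ ‖deriv g w‖ + ‖deriv g p‖ := norm_sub_le _ _
          _ ≤ _ := by linarith [hb w hw]) hz
    simpa [dist_eq_norm] using this
  have hM : ∀ z ∈ Metric.closedBall p (ρ/6), ‖(g z - deriv g p * z) - (g p - deriv g p * p)‖
      ≤ A / 2 * ‖z - p‖ := by
    intro z hz
    refine Convex.norm_image_sub_le_of_norm_hasDerivWithin_le (s := Metric.closedBall p (ρ/6))
      (f := fun z => g z - deriv g p * z) (f' := fun z => deriv g z - deriv g p) ?_ ?_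
      (convex_closedBall _ _) (Metric.mem_closedBall_self (by positivity)) hz
    · intro x hx
      have h1 := (hg.differentiableAt (Metric.isOpen_ball.mem_nhds (hsub hx))).hasDerivAt
      have h2 := (hasDerivAt_id x).const_mul (deriv g p)
      have h3 := (h1.sub h2).hasDerivWithinAt (s := Metric.closedBall p (ρ/6))
      rw [mul_one] at h3
      exact h3
    · intro x hx
      refine (hS x (hsub hx)).trans ?_
      rw [mem_closedBall_iff_norm] at hx
      calc 3 * A / ρ * ‖x - p‖ ≤ 3 * A / ρ * (ρ/6) := by gcongr
        _ = A / 2 := by field_simp; norm_num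
  have key := DiffContOnCl.ball_subset_image_closedBall (f := g) (z₀ := p) (r := ρ/6)
    (ε := ρ * A / 12) (hg.mono (by rw [closure_ball p (by positivity)]; exact hsub)).diffContOnCl (by positivity) ?_ ?_
  · have e : ρ * A / 12 / 2 = ρ * A / 24 := by ring
    rw [e] at key
    exact key.trans (image_mono hsub)
  · intro z hz
    have hz' := hM z (Metric.sphere_subset_closedBall hz)
    rw [mem_sphere_iff_norm] at hz
    have e : g z - g p = deriv g p * (z - p) + ((g z - deriv g p * z) - (g p - deriv g p * p)) := by
      ring
    rw [e]
    have h1 := norm_sub_le_norm_add (deriv g p * (z - p)) ((g z - deriv g p * z) - (g p - deriv g p * p))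
    rw [norm_mul, ← hA, hz] at h1
    rw [hz] at hz'
    nlinarith
  · have := (hg.differentiableAt (Metric.isOpen_ball.mem_nhds hpp)).hasDerivAt.eventually_ne
      (c := g p) h0
    exact (this.frequently).filter_mono nhdsWithin_le_nhds

lemma aux_bloch {g : ℂ → ℂ} {a : ℂ} {R s : ℝ} (hR : 0 < R) (hs : 0 < s)
    (hg : DifferentiableOn ℂ g (Metric.ball a R))
    (hb : ∀ c, ¬ Metric.ball c s ⊆ g '' Metric.ball a R) :
    ‖deriv g a‖ * R ≤ 96 * s := by
  by_contra! hcon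
  have hd := hg.deriv Metric.isOpen_ball
  have hsub : Metric.closedBall a (R/2) ⊆ Metric.ball a R :=
    Metric.closedBall_subset_ball (by linarith)
  obtain ⟨p, hp, hmax⟩ := (isCompact_closedBall a (R/2)).exists_isMaxOn
    (f := fun z => ‖deriv g z‖ * (R/2 - ‖z - a‖)) ⟨a, Metric.mem_closedBall_self (by positivity)⟩
    ((hd.continuousOn.mono hsub).norm.mul (by fun_prop))
  have hpa := hmax (Metric.mem_closedBall_self (by positivity) : a ∈ Metric.closedBall a (R/2))
  simp only [sub_self, norm_zero, sub_zero, mem_ofPred_eq] at hpa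
  have hn := norm_nonneg (deriv g p)
  have hpos : 0 < ‖deriv g p‖ * (R/2 - ‖p - a‖) := by nlinarith
  have hA0 : 0 < ‖deriv g p‖ := hn.lt_of_ne (by rintro h; rw [← h] at hpos; simp at hpos)
  have hρ : 0 < (R/2 - ‖p - a‖) := by
    by_contra! h; nlinarith
  have hsub2 : Metric.ball p ((R/2 - ‖p - a‖)/2) ⊆ Metric.closedBall a (R/2) := by
    intro z hz
    rw [mem_ball_iff_norm] at hz
    rw [mem_closedBall_iff_norm]
    have := norm_sub_le_norm_sub_add_norm_sub z p a
    linarith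
  have := aux_local (g := g) (p := p) (ρ := (R/2 - ‖p - a‖)/2) (by positivity)
    (hg.mono (hsub2.trans hsub)) (norm_pos_iff.1 hA0) (by
      intro z hz
      have h1 := hmax (hsub2 hz)
      simp only [mem_ofPred_eq] at h1
      rw [mem_ball_iff_norm] at hz
      have h2 := norm_sub_le_norm_sub_add_norm_sub z p a
      have h3 : (R/2 - ‖p - a‖)/2 ≤ R/2 - ‖z - a‖ := by linarith
      have h4 := mul_le_mul_of_nonneg_left h3 (norm_nonneg (deriv g z))
      have h5 : ‖deriv g z‖ * ((R/2 - ‖p - a‖)/2) ≤ (2 * ‖deriv g p‖) * ((R/2 - ‖p - a‖)/2) := by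
        linarith
      exact le_of_mul_le_mul_right h5 (by positivity))
  refine hb (g p) ((Metric.ball_subset_ball ?_).trans (this.trans (image_mono (hsub2.trans hsub))))
  linarith

lemma aux_cosh_grid (y : ℝ) (hy : 0 ≤ y) : ∃ t, y ≤ t ∧ t ≤ y + 2 ∧ ∃ n : ℤ, Real.cosh t = n := by
  have h1 : (⌈Real.cosh y⌉ : ℝ) ∈ Icc (Real.cosh y) (Real.cosh (y+2)) := by
    refine ⟨Int.le_ceil _, (Int.ceil_lt_add_one _).le.trans ?_⟩
    rw [Real.cosh_add]
    have a := Real.one_le_cosh y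
    have b := Real.sinh_nonneg_iff.2 hy
    have c : (2:ℝ) ≤ Real.sinh 2 := Real.self_le_sinh_iff.2 (by norm_num)
    have d := Real.sinh_lt_cosh 2
    nlinarith [mul_nonneg b (by linarith : 0 ≤ Real.sinh 2)]
  obtain ⟨t, ht, he⟩ := intermediate_value_Icc (by linarith : y ≤ y + 2) Real.continuous_cosh.continuousOn h1
  exact ⟨t, ht.1, ht.2, _, he⟩

lemma aux_grid (c : ℂ) : ∃ v ∈ Metric.ball c 4, ∃ n : ℤ, Complex.cos v = n := by
  have h : ∃ t : ℝ, |t - c.im| ≤ 2 ∧ ∃ n : ℤ, Real.cosh t = n := by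
    rcases le_total 0 c.im with h | h
    · obtain ⟨t, h1, h2, h3⟩ := aux_cosh_grid c.im h
      exact ⟨t, by rw [abs_le]; constructor <;> linarith, h3⟩
    · obtain ⟨t, h1, h2, h3⟩ := aux_cosh_grid (-c.im) (by linarith)
      exact ⟨-t, by rw [abs_le]; constructor <;> linarith, by simpa using h3⟩
  obtain ⟨t, ht, n, hn⟩ := h
  set k := round (c.re / Real.pi) with hk
  have hr := abs_sub_round (c.re / Real.pi)
  rw [← hk] at hr
  have hp := Real.pi_pos
  refine ⟨(((k * Real.pi : ℝ) : ℂ) + (t : ℂ) * Complex.I), ?_, ?_⟩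
  · rw [mem_ball_iff_norm]
    refine (Complex.norm_le_abs_re_add_abs_im _).trans_lt ?_
    have e1 : ((((k * Real.pi : ℝ) : ℂ) + (t : ℂ) * Complex.I) - c).re = -((c.re / Real.pi - k) * Real.pi) := by
      rw [Complex.sub_re, Complex.add_re, Complex.ofReal_re]; simp; field_simp; ring
    have e2 : ((((k * Real.pi : ℝ) : ℂ) + (t : ℂ) * Complex.I) - c).im = t - c.im := by
      rw [Complex.sub_im, Complex.add_im, Complex.ofReal_im]; simp
    rw [e1, e2, abs_neg, abs_mul, abs_of_pos hp]
    nlinarith [Real.pi_lt_d2]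
  · have hm : ∃ m : ℤ, Real.cos (k * Real.pi) = m := by
      rw [Real.cos_int_mul_pi]
      rcases Int.even_or_odd k with h | h
      · exact ⟨1, by rw [h.neg_one_zpow]; simp⟩
      · exact ⟨-1, by rw [h.neg_one_zpow]; simp⟩
    obtain ⟨m, hm⟩ := hm
    refine ⟨m * n, ?_⟩
    rw [Complex.cos_add_mul_I, ← Complex.ofReal_cos, ← Complex.ofReal_cosh, ← Complex.ofReal_sin, hn, Real.sin_int_mul_pi, hm]
    simp

lemma aux_norm_cos_le (v : ℂ) : ‖Complex.cos v‖ ≤ Real.exp ‖v‖ := by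
  rw [Complex.cos, norm_div]
  have h1 := Complex.norm_exp_le_exp_norm (v * Complex.I)
  have h2 := Complex.norm_exp_le_exp_norm (-v * Complex.I)
  simp only [norm_mul, norm_neg, Complex.norm_I, mul_one] at h1 h2
  have h3 := norm_add_le (Complex.exp (v * Complex.I)) (Complex.exp (-v * Complex.I))
  rw [Complex.norm_two]
  linarith

lemma aux_schottky (R M : ℝ) (hR : 0 < R) : ∃ C : ℝ, ∀ (a : ℂ) (f : ℂ → ℂ),
    DifferentiableOn ℂ f (Metric.ball a R) →
    (∀ z ∈ Metric.ball a R, f z ≠ 0) → (∀ z ∈ Metric.ball a R, f z ≠ 1) →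
    ‖f a‖ ≤ M → ∀ z ∈ Metric.closedBall a (R/2), ‖f z‖ ≤ C := by
  set B := Real.pi + (Real.pi + (2 * M + 1)) with hB
  refine ⟨Real.exp (Real.exp (B + 384) * Real.pi) + 1, ?_⟩
  intro a f hf h0 h1 hM z hz
  have hp := Real.pi_pos
  have hpc : (Real.pi : ℂ) ≠ 0 := by exact_mod_cast hp.ne'
  have haa : a ∈ Metric.ball a R := Metric.mem_ball_self hR
  have hsub : Metric.closedBall a (R/2) ⊆ Metric.ball a R :=
    Metric.closedBall_subset_ball (by linarith)
  obtain ⟨F, hF, hFc, hFa⟩ := aux_arccos (h := fun z => 2 * f z - 1) hR (by fun_prop)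
    (fun z hz h => h1 z hz (by linear_combination h / 2))
    (fun z hz h => h0 z hz (by linear_combination h / 2))
  have hFint : ∀ z ∈ Metric.ball a R, ∀ n : ℤ, F z / Real.pi ≠ n := by
    intro z hz n hn
    have hFz : F z = ((n * Real.pi : ℝ) : ℂ) := by
      rw [div_eq_iff hpc] at hn; rw [hn]; push_cast; rfl
    have e := hFc z hz
    rw [hFz, ← Complex.ofReal_cos, Real.cos_int_mul_pi] at e
    rcases Int.even_or_odd n with h | h
    · rw [h.neg_one_zpow] at e
      push_cast at e
      exact h1 z hz (by linear_combination -e / 2)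
    · rw [h.neg_one_zpow] at e
      push_cast at e
      exact h0 z hz (by linear_combination -e / 2)
  obtain ⟨g, hg, hgc, hga⟩ := aux_arccos (h := fun z => F z / Real.pi) hR (by fun_prop)
    (fun z hz h => hFint z hz 1 (by simpa using h))
    (fun z hz h => hFint z hz (-1) (by simpa using h))
  have hno : ∀ z ∈ Metric.ball a R, ∀ n : ℤ, Complex.cos (g z) ≠ n := by
    intro z hz n hn
    rw [hgc z hz] at hn
    exact hFint z hz n hn
  have hder : ∀ w ∈ Metric.closedBall a (R/2), ‖deriv g w‖ ≤ 768 / R := by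
    intro w hw
    have hs : Metric.ball w (R/2) ⊆ Metric.ball a R := by
      intro x hx
      rw [mem_closedBall_iff_norm] at hw
      rw [mem_ball_iff_norm] at *
      have := norm_sub_le_norm_sub_add_norm_sub x w a
      linarith
    have := aux_bloch (g := g) (a := w) (R := R/2) (s := 4) (by positivity) (by norm_num)
      (hg.mono hs) (by
        intro c hc
        obtain ⟨v, hv, n, hn⟩ := aux_grid c
        obtain ⟨x, hx, rfl⟩ := hc hv
        exact hno x (hs hx) n hn)
    rw [le_div_iff₀ hR]
    linarith
  have hgz : ‖g z - g a‖ ≤ 768 / R * ‖z - a‖ :=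
    Convex.norm_image_sub_le_of_norm_deriv_le (s := Metric.closedBall a (R/2))
      (fun x hx => hg.differentiableAt (Metric.isOpen_ball.mem_nhds (hsub hx))) hder
      (convex_closedBall _ _) (Metric.mem_closedBall_self (by positivity)) hz
  have hgz2 : ‖g z - g a‖ ≤ 384 := by
    rw [mem_closedBall_iff_norm] at hz
    calc _ ≤ 768 / R * ‖z - a‖ := hgz
      _ ≤ 768 / R * (R / 2) := by gcongr
      _ = 384 := by field_simp; norm_num
  have hFa' : ‖F a‖ ≤ Real.pi + (2 * M + 1) := by
    have : ‖2 * f a - 1‖ ≤ 2 * M + 1 := by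
      refine (norm_sub_le _ _).trans ?_
      simp; linarith
    linarith
  have hFpi : ‖F a / Real.pi‖ ≤ ‖F a‖ := by
    rw [norm_div, Complex.norm_real, Real.norm_of_nonneg hp.le]
    exact div_le_self (norm_nonneg _) (by linarith [Real.pi_gt_three])
  have hgn : ‖g z‖ ≤ B + 384 := by
    have := norm_le_norm_add_norm_sub' (g z) (g a)
    linarith
  have hzz := hsub hz
  have hFz : ‖F z‖ ≤ Real.exp (B + 384) * Real.pi := by
    have := aux_norm_cos_le (g z)
    rw [hgc z hzz, norm_div, Complex.norm_real, Real.norm_of_nonneg hp.le, div_le_iff₀ hp] at this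
    refine this.trans ?_
    gcongr
  have hfz := aux_norm_cos_le (F z)
  rw [hFc z hzz] at hfz
  have h5 : ‖2 * f z - 1‖ ≤ Real.exp (Real.exp (B + 384) * Real.pi) :=
    hfz.trans (Real.exp_le_exp.2 hFz)
  have h6 : ‖2 * f z‖ ≤ ‖2 * f z - 1‖ + ‖(1:ℂ)‖ := by
    have := norm_add_le (2 * f z - 1) 1
    rwa [sub_add_cancel] at this
  rw [norm_mul, Complex.norm_two, norm_one] at h6
  have := norm_nonneg (f z)
  linarith

/-- Schottky on a circle in a punctured disc. -/
lemma aux_circle (w u v : ℂ) (r : ℝ) (hr : 0 < r) (huv : u ≠ v) (k : ℕ) :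
    ∀ M : ℝ, ∃ C : ℝ, ∀ f : ℂ → ℂ, Differentiable ℂ f →
    (∀ x ∈ Metric.ball w (2 * r), x ≠ w → f x ≠ u ∧ f x ≠ v) →
    ∀ s t : ℝ, |t - s| ≤ k / 2 → ‖f (circleMap w r s)‖ ≤ M → ‖f (circleMap w r t)‖ ≤ C := by
  have hvu : v - u ≠ 0 := sub_ne_zero.2 huv.symm
  induction k with
  | zero =>
    intro M
    refine ⟨M, fun f _ _ s t hst h => ?_⟩
    have : t = s := by
      have : |t - s| = 0 := le_antisymm (by simpa using hst) (abs_nonneg _)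
      linarith [abs_eq_zero.1 this]
    rwa [this]
  | succ k ih =>
    intro M
    obtain ⟨C, hC⟩ := ih M
    obtain ⟨C', hC'⟩ := aux_schottky r ((C + ‖u‖) / ‖v - u‖) hr
    refine ⟨C' * ‖v - u‖ + ‖u‖, fun f hf ho s t hst h => ?_⟩
    -- intermediate point
    have hkk : (0:ℝ) < k + 1 := by positivity
    set q : ℝ := s + (t - s) * (k / (k + 1)) with hq
    push_cast at hst
    have hqs : |q - s| ≤ k / 2 := by
      have : q - s = (t - s) * (k / (k + 1)) := by rw [hq]; ring
      rw [this, abs_mul, abs_of_nonneg (by positivity : (0:ℝ) ≤ k / (k+1))]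
      calc |t - s| * (k / (k + 1)) ≤ ((k + 1) / 2) * (k / (k + 1)) := by gcongr
        _ = k / 2 := by field_simp
    have hqt : |t - q| ≤ 1 / 2 := by
      have : t - q = (t - s) * (1 / (k + 1)) := by rw [hq]; field_simp; ring
      rw [this, abs_mul, abs_of_nonneg (by positivity : (0:ℝ) ≤ 1 / (k+1))]
      calc |t - s| * (1 / (k + 1)) ≤ ((k + 1) / 2) * (1 / (k + 1)) := by gcongr
        _ = 1 / 2 := by field_simp
    have h1 := hC f hf ho s q hqs h
    have hnq : ‖circleMap w r q - w‖ = r := by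
      rw [circleMap_sub_center, norm_circleMap_zero, abs_of_pos hr]
    have hball : ∀ x ∈ Metric.ball (circleMap w r q) r, f x ≠ u ∧ f x ≠ v := by
      intro x hx
      rw [mem_ball_iff_norm] at hx
      apply ho
      · rw [mem_ball_iff_norm]
        have := norm_sub_le_norm_sub_add_norm_sub x (circleMap w r q) w
        linarith
      · rintro rfl
        rw [norm_sub_rev] at hx
        linarith
    have hd : circleMap w r t ∈ Metric.closedBall (circleMap w r q) (r / 2) := by
      have hl := (lipschitzWith_circleMap w r).dist_le_mul t q
      rw [Metric.mem_closedBall]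
      refine hl.trans ?_
      rw [Real.dist_eq]
      simp only [Real.coe_nnabs, abs_of_pos hr]
      nlinarith
    have h2 := hC' (circleMap w r q) (fun x => (f x - u) / (v - u))
      (by fun_prop)
      (fun x hx => div_ne_zero (sub_ne_zero.2 (hball x hx).1) hvu)
      (fun x hx hh => (hball x hx).2 (by
        rw [div_eq_one_iff_eq hvu] at hh
        linear_combination hh))
      (by
        rw [norm_div]
        gcongr
        exact (norm_sub_le _ _).trans (by linarith)) _ hd
    rw [norm_div, div_le_iff₀ (norm_pos_iff.2 hvu)] at h2
    have := norm_le_norm_add_norm_sub' (f (circleMap w r t)) u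
    linarith

lemma aux_weak_montel (w : ℂ) (r C : ℝ) (hr : 0 < r) (f : ℕ → ℂ → ℂ)
    (hf : ∀ n, Differentiable ℂ (f n)) (hb : ∀ n, ∀ x ∈ Metric.ball w r, ‖f n x‖ ≤ C) :
    ∃ φ : ℕ → ℕ, StrictMono φ ∧ ∃ g : ℂ → ℂ, DifferentiableOn ℂ g (Metric.ball w (r/4)) ∧
      TendstoLocallyUniformlyOn (fun n => f (φ n)) g Filter.atTop (Metric.ball w (r/4)) := by
  let K := Metric.closedBall w (r/4)
  have hKc : IsCompact K := isCompact_closedBall _ _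
  have : CompactSpace K := isCompact_iff_compactSpace.1 hKc
  let G : ℕ → BoundedContinuousFunction K ℂ := fun n =>
    BoundedContinuousFunction.mkOfCompact ⟨fun x => f n x, (hf n).continuous.comp continuous_subtype_val⟩
  have hC0 : 0 ≤ C := (norm_nonneg _).trans (hb 0 w (Metric.mem_ball_self hr))
  have hKr : ∀ x ∈ K, Metric.ball x (r * (3/4)) ⊆ Metric.ball w r := by
    intro x hx y hy
    have hx' : ‖x - w‖ ≤ r / 4 := mem_closedBall_iff_norm.1 hx
    rw [mem_ball_iff_norm] at *
    have := norm_sub_le_norm_sub_add_norm_sub y x w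
    linarith
  have hKr' : K ⊆ Metric.ball w r := Metric.closedBall_subset_ball (by linarith)
  have hlip : ∀ n, ∀ x ∈ K, ∀ y ∈ K, dist (f n y) (f n x) ≤ (2 * C) / (r * (3/4)) * dist y x := by
    intro n x hx y hy
    refine Complex.dist_le_div_mul_dist_of_mapsTo_ball (hf n).differentiableOn ?_ ?_
    · intro z hz
      rw [mem_closedBall_iff_norm]
      refine (norm_sub_le _ _).trans ?_
      linarith [hb n z (hKr x hx hz), hb n x (hKr' hx)]
    · have hx' : ‖x - w‖ ≤ r / 4 := mem_closedBall_iff_norm.1 hx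
      have hy' : ‖y - w‖ ≤ r / 4 := mem_closedBall_iff_norm.1 hy
      rw [mem_ball_iff_norm]
      have := norm_sub_le_norm_sub_add_norm_sub y w x
      rw [norm_sub_rev w x] at this
      linarith
  have hcomp : IsCompact (closure (range G)) := by
    refine BoundedContinuousFunction.arzela_ascoli (Metric.closedBall 0 C) (isCompact_closedBall _ _)
      _ ?_ ?_
    · rintro _ x ⟨n, rfl⟩
      exact mem_closedBall_zero_iff.2 (hb n x (hKr' x.2))
    · refine Metric.equicontinuous_of_continuity_modulus (fun t => (2 * C) / (r * (3/4)) * t) ?_ _ ?_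
      · have : Continuous (fun t : ℝ => (2 * C) / (r * (3/4)) * t) := by fun_prop
        simpa using this.tendsto 0
      · rintro x y ⟨_, n, rfl⟩
        exact hlip n y y.2 x x.2
  obtain ⟨g, -, φ, hφ, hg⟩ := hcomp.tendsto_subseq (x := G) (fun n => subset_closure ⟨n, rfl⟩)
  have hu := BoundedContinuousFunction.tendsto_iff_tendstoUniformly.1 hg
  classical
  let g' : ℂ → ℂ := fun x => if h : x ∈ K then g ⟨x, h⟩ else 0
  have hu' : TendstoUniformlyOn (fun n => f (φ n)) g' atTop K := by
    rw [tendstoUniformlyOn_iff_tendstoUniformly_comp_coe]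
    have e : g' ∘ Subtype.val = (g : K → ℂ) := by
      funext x
      simp only [Function.comp_apply, g']
      rw [dif_pos x.2]
    rw [e]
    exact hu
  have hl := (hu'.mono Metric.ball_subset_closedBall).tendstoLocallyUniformlyOn
  refine ⟨φ, hφ, g', ?_, hl⟩
  exact hl.differentiableOn (Eventually.of_forall fun n => (hf _).differentiableOn) Metric.isOpen_ball

lemma aux_circle_param (w x : ℂ) (r : ℝ) (hx : x ∈ Metric.sphere w r) :
    ∃ t : ℝ, |t| ≤ 7 / 2 ∧ circleMap w r t = x := by
  refine ⟨(x - w).arg, (Complex.abs_arg_le_pi _).trans (by linarith [Real.pi_lt_d2]), ?_⟩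
  rw [mem_sphere_iff_norm] at hx
  rw [circleMap, ← hx, Complex.norm_mul_exp_arg_mul_I]; ring

lemma aux_normal (w u v : ℂ) (r : ℝ) (hr : 0 < r) (huv : u ≠ v) (f : ℕ → ℂ → ℂ)
    (hf : ∀ n, Differentiable ℂ (f n))
    (ho : ∀ n, ∀ x ∈ Metric.ball w (2 * r), x ≠ w → f n x ≠ u)
    (hv : ∀ n, ∀ x ∈ Metric.ball w (2 * r), f n x ≠ v) :
    ∃ φ : ℕ → ℕ, StrictMono φ ∧
      ((∃ g : ℂ → ℂ, DifferentiableOn ℂ g (Metric.ball w (r/4)) ∧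
          TendstoLocallyUniformlyOn (fun n => f (φ n)) g Filter.atTop (Metric.ball w (r/4))) ∨
        ∀ M : ℝ, ∀ᶠ n in Filter.atTop, ∀ z ∈ Metric.ball w (r/4), M ≤ ‖f (φ n) z‖) := by
  have ho' : ∀ n, (∀ x ∈ Metric.ball w (2 * r), x ≠ w → f n x ≠ u ∧ f n x ≠ v) :=
    fun n x hx h => ⟨ho n x hx h, hv n x hx⟩
  have hcl : closure (Metric.ball w r) = Metric.closedBall w r := closure_ball w hr.ne'
  have hfr : frontier (Metric.ball w r) = Metric.sphere w r := frontier_ball w hr.ne'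
  by_cases hcase : ∃ M : ℝ, ∃ᶠ n in atTop, ‖f n (circleMap w r 0)‖ ≤ M
  · obtain ⟨M, hM⟩ := hcase
    obtain ⟨ψ, hψ, hψM⟩ := extraction_of_frequently_atTop hM
    obtain ⟨C, hC⟩ := aux_circle w u v r hr huv 7 M
    obtain ⟨φ, hφ, h⟩ := aux_weak_montel w r C hr (fun n => f (ψ n)) (fun n => hf _) (by
      intro n x hx
      refine Complex.norm_le_of_forall_mem_frontier_norm_le Metric.isBounded_ball
        (hf (ψ n)).diffContOnCl ?_ (subset_closure hx)
      intro y hy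
      rw [hfr] at hy
      obtain ⟨t, ht, rfl⟩ := aux_circle_param w y r hy
      exact hC _ (hf _) (ho' _) 0 t (by simpa using ht) (hψM n))
    exact ⟨ψ ∘ φ, hψ.comp hφ, Or.inl h⟩
  · push Not at hcase
    refine ⟨id, strictMono_id, Or.inr fun M => ?_⟩
    set L := max M 0 + 2 * ‖v‖ + 1 with hL
    have hL1 : 0 < max M 0 + ‖v‖ + 1 := by positivity
    obtain ⟨C, hC⟩ := aux_circle w u v r hr huv 7 L
    filter_upwards [hcase C] with n hn z hz
    have hsub : Metric.closedBall w r ⊆ Metric.ball w (2 * r) :=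
      Metric.closedBall_subset_ball (by linarith)
    have hzr : z ∈ Metric.ball w r := Metric.ball_subset_ball (by linarith) hz
    have := Complex.norm_le_of_forall_mem_frontier_norm_le (f := fun x => (f n x - v)⁻¹)
      (C := (max M 0 + ‖v‖ + 1)⁻¹) (Metric.isBounded_ball (x := w) (r := r)) (by
        refine DifferentiableOn.diffContOnCl ?_
        rw [hcl]
        refine DifferentiableOn.inv ((hf n).differentiableOn.sub_const v) ?_
        intro x hx
        exact sub_ne_zero.2 (hv n x (hsub hx))) (by
        intro y hy
        rw [hfr] at hy
        obtain ⟨t, ht, rfl⟩ := aux_circle_param w y r hy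
        have h1 : L < ‖f n (circleMap w r t)‖ := by
          by_contra! hcon
          have := hC _ (hf n) (ho' n) t 0 (by simpa using ht) hcon
          linarith
        rw [norm_inv]
        gcongr
        have := norm_le_norm_add_norm_sub' (f n (circleMap w r t)) v
        linarith) (subset_closure hzr)
    rw [norm_inv] at this
    have hpos : 0 < ‖f n z - v‖ :=
      norm_pos_iff.2 (sub_ne_zero.2 (hv n z (hsub (Metric.ball_subset_closedBall hzr))))
    rw [inv_le_inv₀ hpos hL1] at this
    have h3 := norm_sub_le (f n z) v
    have := le_max_left M 0
    simp only [id]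
    linarith

/-- For a semigroup `𝓕` of entire functions (closed under composition,
`D = ℂ`) whose Julia like set is backward invariant, with nonempty exceptional set, and
`z ∈ J(𝓕) \ E(𝓕)`, the Julia like set is the closure of the backward orbit of `z`. -/
theorem julia_eq_closure_backwardOrbit (𝓕 : Set (ℂ → ℂ))
    (hent : ∀ f ∈ 𝓕, Differentiable ℂ f)
    (hsemi : ∀ f ∈ 𝓕, ∀ g ∈ 𝓕, f ∘ g ∈ 𝓕)
    (hback : ∀ f ∈ 𝓕, f ⁻¹' JuliaSet Set.univ 𝓕 ⊆ JuliaSet Set.univ 𝓕)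
    (hE : (ExceptionalSet Set.univ 𝓕).Nonempty)
    (z : ℂ) (hz : z ∈ JuliaSet Set.univ 𝓕 \ ExceptionalSet Set.univ 𝓕) :
    JuliaSet Set.univ 𝓕 = closure (BackwardOrbit Set.univ 𝓕 z) := by
  obtain ⟨e, he⟩ := hE
  obtain ⟨hzJ, hzE⟩ := hz
  have hez : e ≠ z := by
    rintro rfl
    exact hzE he
  apply Subset.antisymm
  · intro w hw
    by_contra hcl
    obtain ⟨ε, hε, hball⟩ := Metric.isOpen_iff.1 isClosed_closure.isOpen_compl w hcl
    have hfin : (BackwardOrbit Set.univ 𝓕 e \ {w}).Finite := Set.Finite.sdiff he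
    obtain ⟨δ, hδ, hball2⟩ := Metric.isOpen_iff.1 hfin.isClosed.isOpen_compl w
      (fun h => h.2 rfl)
    set r := min ε δ / 2 with hr
    have hr0 : 0 < r := by have := lt_min hε hδ; positivity
    have h1 : Metric.ball w (2 * r) ⊆ Metric.ball w ε :=
      Metric.ball_subset_ball (by rw [hr]; linarith [min_le_left ε δ])
    have h2 : Metric.ball w (2 * r) ⊆ Metric.ball w δ :=
      Metric.ball_subset_ball (by rw [hr]; linarith [min_le_right ε δ])
    refine hw.2 ⟨trivial, Metric.ball w (r/4), subset_univ _,
      Metric.ball_mem_nhds _ (by positivity), ?_⟩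
    intro f hf
    obtain ⟨φ, hφ, h⟩ := aux_normal w e z r hr0 hez f (fun n => hent _ (hf n))
      (fun n x hx hxw hfx => hball2 (h2 hx) ⟨⟨trivial, f n, hf n, hfx⟩, hxw⟩)
      (fun n x hx hfx => hball (h1 hx) (subset_closure ⟨trivial, f n, hf n, hfx⟩))
    refine ⟨φ, hφ, h.imp id ?_⟩
    intro h K hK _ M
    filter_upwards [h M] with n hn x hx using hn x (hK hx)
  · have hopen : IsOpen (FatouSet Set.univ 𝓕) := by
      rw [isOpen_iff_mem_nhds]
      rintro x ⟨-, N, hN1, hN2, hN3⟩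
      filter_upwards [eventually_mem_nhds_iff.2 hN2] with y hy
      exact ⟨trivial, N, hN1, hy, hN3⟩
    have hclosed : IsClosed (JuliaSet Set.univ 𝓕) := by
      have : JuliaSet Set.univ 𝓕 = (FatouSet Set.univ 𝓕)ᶜ := by
        rw [JuliaSet, compl_eq_univ_sdiff]
      rw [this]
      exact hopen.isClosed_compl
    refine closure_minimal ?_ hclosed
    rintro w ⟨-, f, hf, rfl⟩
    exact hback f hf hzJ
end

section
/- Let 𝓕 be a family of holomorphic functions on a domain D ⊆ ℂ with E(𝓕) ≠ ∅, and let N ⊆ D be a neighborhood of some point of the Julia like set J(𝓕). Then ℂ \ ⋃_{f ∈ 𝓕} f(N) ⊆ E(𝓕). -/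
open Filter Topology Set

open Metric in
lemma exists_log_aux {c : ℂ} {r : ℝ} (hr : 0 < r) {f : ℂ → ℂ}
    (hf : DifferentiableOn ℂ f (ball c r)) (h0 : ∀ z ∈ ball c r, f z ≠ 0) :
    ∃ l : ℂ → ℂ, DifferentiableOn ℂ l (ball c r) ∧ (∀ z ∈ ball c r, Complex.exp (l z) = f z) ∧
      l c = Complex.log (f c) := by
  have hd : DifferentiableOn ℂ (fun z => deriv f z / f z) (ball c r) :=
    (hf.deriv isOpen_ball).div hf h0
  obtain ⟨l, hlc, hl⟩ := hd.isExactOn_ball.with_val_at c (Complex.log (f c))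
  have hc : c ∈ ball c r := mem_ball_self hr
  refine ⟨l, fun z hz => (hl z hz).differentiableAt.differentiableWithinAt, ?_, hlc⟩
  have key : ∀ z ∈ ball c r, f z * Complex.exp (-l z) = f c * Complex.exp (-l c) := by
    intro z hz
    have hder : ∀ x ∈ ball c r, HasDerivAt (fun z => f z * Complex.exp (-l z)) 0 x := by
      intro x hx
      have h1 : HasDerivAt f (deriv f x) x :=
        ((hf x hx).differentiableAt (isOpen_ball.mem_nhds hx)).hasDerivAt
      have h2 := h1.mul ((hl x hx).neg.cexp)
      have hx0 := h0 x hx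
      have h3 : deriv f x * Complex.exp ((-l) x) +
          f x * (Complex.exp ((-l) x) * -(deriv f x / f x)) = 0 := by
        field_simp
        ring
      rw [h3] at h2
      exact h2
    have := (convex_ball c r).norm_image_sub_le_of_norm_hasDerivWithin_le (C := 0)
      (fun x hx => (hder x hx).hasDerivWithinAt) (by simp) hc hz
    simpa [sub_eq_zero] using this
  intro z hz
  have h1 := key z hz
  rw [hlc, Complex.exp_neg, Complex.exp_neg, Complex.exp_log (h0 c hc),
    mul_inv_cancel₀ (h0 c hc)] at h1
  have := Complex.exp_ne_zero (l z)
  field_simp at h1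
  exact h1.symm

open Metric in
lemma disc_aux {c : ℂ} {r a : ℝ} (hr : 0 < r) (ha : 0 < a) {h : ℂ → ℂ}
    (hh : DifferentiableOn ℂ h (ball c r)) (hc : ‖deriv h c‖ = a)
    (hb : ∀ z ∈ ball c r, ‖deriv h z‖ ≤ 2 * a) :
    ball (h c) (a * r / 24) ⊆ h '' ball c r := by
  have hcm : c ∈ ball c r := mem_ball_self hr
  have hsub : closedBall c (r / 6) ⊆ ball c r := closedBall_subset_ball (by linarith)
  have hd' : DifferentiableOn ℂ (deriv h) (ball c r) := hh.deriv isOpen_ball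
  have hS : ∀ z ∈ closedBall c (r / 6), ‖deriv h z - deriv h c‖ ≤ a / 2 := by
    intro z hz
    have := Complex.dist_le_div_mul_dist_of_mapsTo_ball (R₂ := 3 * a) hd' (fun w hw => by
      rw [mem_closedBall, dist_eq_norm]
      refine (norm_sub_le _ _).trans ?_
      have := hb w hw
      linarith) (hsub hz)
    rw [dist_eq_norm] at this
    refine this.trans ?_
    have h6 : dist z c ≤ r / 6 := hz
    calc 3 * a / r * dist z c ≤ 3 * a / r * (r / 6) := by gcongr
      _ = a / 2 := by field_simp; ring
  have hdiff : ∀ x ∈ ball c r, HasDerivAt h (deriv h x) x := fun x hx =>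
    ((hh x hx).differentiableAt (isOpen_ball.mem_nhds hx)).hasDerivAt
  have hlow : ∀ z ∈ closedBall c (r / 6), a / 2 * ‖z - c‖ ≤ ‖h z - h c‖ := by
    intro z hz
    have := (convex_closedBall c (r / 6)).norm_image_sub_le_of_norm_hasDerivWithin_le (C := a / 2)
      (f := fun z => h z - deriv h c * z) (f' := fun z => deriv h z - deriv h c * 1)
      (fun x hx => ((hdiff x (hsub hx)).sub ((hasDerivAt_id x).const_mul _)).hasDerivWithinAt)
      (by intro x hx; simpa using hS x hx) (mem_closedBall_self (by positivity)) hz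
    have h2 : ‖deriv h c * (z - c)‖ = a * ‖z - c‖ := by rw [norm_mul, hc]
    have h3 : deriv h c * (z - c) = (h z - h c) - (h z - deriv h c * z - (h c - deriv h c * c)) := by
      ring
    have h4 := norm_sub_le (h z - h c) (h z - deriv h c * z - (h c - deriv h c * c))
    rw [← h3, h2] at h4
    linarith
  have hdc : DiffContOnCl ℂ h (ball c (r / 6)) := (hh.mono hsub).diffContOnCl_ball subset_rfl
  have := hdc.ball_subset_image_closedBall (ε := a * r / 12) (by positivity) (fun z hz => by
    have h1 := hlow z (sphere_subset_closedBall hz)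
    rw [mem_sphere_iff_norm] at hz
    rw [hz] at h1
    linarith) (by
    have h1 : ∀ᶠ z in 𝓝[≠] c, h z ≠ h c := by
      have : ∀ᶠ z in 𝓝[≠] c, z ∈ closedBall c (r / 6) :=
        nhdsWithin_le_nhds (closedBall_mem_nhds c (by positivity))
      filter_upwards [this, self_mem_nhdsWithin] with z hz hne heq
      have h1 := hlow z hz
      rw [heq, sub_self, norm_zero] at h1
      have : 0 < ‖z - c‖ := norm_pos_iff.2 (sub_ne_zero.2 hne)
      nlinarith
    exact h1.frequently.filter_mono nhdsWithin_le_nhds)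
  refine Subset.trans ?_ (this.trans (image_mono hsub))
  apply ball_subset_ball
  linarith

open Metric in
lemma bloch_aux {c : ℂ} {R : ℝ} (hR : 0 < R) {g : ℂ → ℂ} {U : Set ℂ} (hU : IsOpen U)
    (hUR : closedBall c R ⊆ U) (hg : DifferentiableOn ℂ g U) {L : ℝ} (hL : 0 < L)
    (hom : ∀ y : ℂ, ¬ ball y L ⊆ g '' U) : ‖deriv g c‖ * R ≤ 48 * L := by
  by_contra! hcon
  have hd' : DifferentiableOn ℂ (deriv g) U := hg.deriv hU
  have hcont : ContinuousOn (fun z => ‖deriv g z‖ * (R - dist z c)) (closedBall c R) := by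
    apply ContinuousOn.mul
    · exact (hd'.continuousOn.mono hUR).norm
    · fun_prop
  obtain ⟨p, hp, hmax⟩ := (isCompact_closedBall c R).exists_isMaxOn
    ⟨c, mem_closedBall_self hR.le⟩ hcont
  have h1 : ‖deriv g c‖ * R ≤ ‖deriv g p‖ * (R - dist p c) := by
    simpa using hmax (mem_closedBall_self hR.le : c ∈ closedBall c R)
  have hpos : 0 < ‖deriv g p‖ * (R - dist p c) := by linarith
  have hs0 : 0 ≤ R - dist p c := by have : dist p c ≤ R := hp; linarith
  have hs : 0 < R - dist p c := by
    rcases hs0.lt_or_eq with h | h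
    · exact h
    · rw [← h] at hpos; simp at hpos
  have ha : 0 < ‖deriv g p‖ := by
    by_contra! h; nlinarith
  set s := R - dist p c with hsdef
  have hsub : ball p (s / 2) ⊆ closedBall c R := by
    intro z hz
    have h2 : dist z p < s / 2 := hz
    have := dist_triangle z p c
    rw [mem_closedBall]; linarith
  have key := disc_aux (c := p) (r := s / 2) (h := g) (by positivity) ha
    (hg.mono (hsub.trans hUR)) rfl (by
      intro z hz
      have h2 : dist z p < s / 2 := hz
      have h3 := dist_triangle z p c
      have h4 : ‖deriv g z‖ * (R - dist z c) ≤ ‖deriv g p‖ * s := hmax (hsub hz)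
      have h5 : s / 2 ≤ R - dist z c := by linarith
      have h6 : ‖deriv g z‖ * (s / 2) ≤ ‖deriv g p‖ * s :=
        (mul_le_mul_of_nonneg_left h5 (norm_nonneg _)).trans h4
      by_contra! h7
      nlinarith)
  apply hom (g p)
  refine Subset.trans (ball_subset_ball ?_) (key.trans (image_mono (hsub.trans hUR)))
  linarith

lemma lattice_real_aux (x : ℝ) (hx : 0 ≤ x) :
    ∃ a : ℝ, |a - x| ≤ 1 ∧ ∃ m : ℤ, Real.cosh (2 * a) = 2 * m - 1 := by
  have hcont : ContinuousOn (fun a => Real.cosh (2 * a)) (Icc x (x + 1)) := by fun_prop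
  have hiv := intermediate_value_Icc (by linarith : x ≤ x + 1) hcont
  set m : ℤ := ⌈(Real.cosh (2 * x) + 1) / 2⌉
  have h1 : (Real.cosh (2 * x) + 1) / 2 ≤ m := Int.le_ceil _
  have h2 : (m : ℝ) < (Real.cosh (2 * x) + 1) / 2 + 1 := Int.ceil_lt_add_one _
  have h3 : Real.cosh (2 * x) + 2 ≤ Real.cosh (2 * (x + 1)) := by
    have e : 2 * (x + 1) = 2 * x + 2 := by ring
    rw [e, Real.cosh_add]
    have hc1 : 1 ≤ Real.cosh (2 * x) := Real.one_le_cosh _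
    have hs0 : 0 ≤ Real.sinh (2 * x) := Real.sinh_nonneg_iff.2 (by linarith)
    have hs2 : 0 ≤ Real.sinh 2 := Real.sinh_nonneg_iff.2 (by norm_num)
    have hc2 : 3 ≤ Real.cosh 2 := by
      have := Real.cosh_two_mul 1
      have h5 : 1 ≤ Real.sinh 1 := Real.self_le_sinh_iff.2 (by norm_num)
      have h6 := Real.cosh_sq 1
      rw [mul_one] at this
      nlinarith
    nlinarith [mul_nonneg hs0 hs2]
  obtain ⟨a, ha, ham⟩ := hiv (show (2 * m - 1 : ℝ) ∈ _ from ⟨by linarith, by linarith⟩)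
  exact ⟨a, abs_le.2 ⟨by linarith [ha.1], by linarith [ha.2]⟩, m, ham⟩

lemma lattice_real_aux' (x : ℝ) :
    ∃ a : ℝ, |a - x| ≤ 1 ∧ ∃ m : ℤ, Real.cosh (2 * a) = 2 * m - 1 := by
  rcases le_total 0 x with hx | hx
  · exact lattice_real_aux x hx
  · obtain ⟨a, h1, m, h2⟩ := lattice_real_aux (-x) (by linarith)
    refine ⟨-a, ?_, m, ?_⟩
    · rw [← abs_neg]; convert h1 using 2; ring
    · rw [mul_neg, Real.cosh_neg, h2]

lemma lattice_aux (c : ℂ) : ∃ p : ℂ, ‖p - c‖ < 3 ∧ ∃ k : ℤ, Complex.cosh p ^ 2 = k := by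
  obtain ⟨a, ha, m, hm⟩ := lattice_real_aux' c.re
  set n : ℤ := round (c.im / (Real.pi / 2))
  have hn : |(n : ℝ) * (Real.pi / 2) - c.im| ≤ 1 := by
    have h1 : |c.im / (Real.pi / 2) - n| ≤ 1 / 2 := abs_sub_round _
    have h2 : (n : ℝ) * (Real.pi / 2) - c.im = -((c.im / (Real.pi / 2) - n) * (Real.pi / 2)) := by
      have := Real.pi_pos
      field_simp; ring
    rw [h2, abs_neg, abs_mul, abs_of_pos (by positivity : 0 < Real.pi / 2)]
    have := Real.pi_lt_four
    have := Real.pi_pos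
    nlinarith
  have hc2 : Complex.cosh (2 * (a : ℂ)) = 2 * m - 1 := by
    have := congrArg (fun t : ℝ => (t : ℂ)) hm
    push_cast at this
    exact this
  refine ⟨⟨a, n * (Real.pi / 2)⟩, ?_, ?_⟩
  · refine (Complex.norm_le_abs_re_add_abs_im _).trans_lt ?_
    simp only [Complex.sub_re, Complex.sub_im]
    linarith
  · set p : ℂ := ⟨a, n * (Real.pi / 2)⟩ with hp
    have h2p : 2 * p = 2 * (a : ℂ) + (n * Real.pi : ℝ) * Complex.I := by
      apply Complex.ext <;> simp [hp] 
      ring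
    have hsq : Complex.cosh p ^ 2 = (1 + Complex.cosh (2 * p)) / 2 := by
      have h1 := Complex.cosh_two_mul p
      have h2 := Complex.cosh_sq p
      rw [h1]
      linear_combination (1 / 2 : ℂ) * h2
    have hco : Complex.cosh (2 * p) = (Real.cos (n * Real.pi) : ℂ) * (2 * m - 1) := by
      rw [h2p, Complex.cosh_add, Complex.cosh_mul_I, Complex.sinh_mul_I, hc2,
        ← Complex.ofReal_cos, ← Complex.ofReal_sin, Real.sin_int_mul_pi]
      push_cast; ring
    rw [hsq, hco]
    rcases Int.even_or_odd n with h | h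
    · refine ⟨m, ?_⟩
      rw [Real.cos_int_mul_pi, h.neg_one_zpow]; push_cast; ring
    · refine ⟨1 - m, ?_⟩
      rw [Real.cos_int_mul_pi, h.neg_one_zpow]; push_cast; ring

lemma norm_log_aux {w : ℂ} (hw : w ≠ 0) {M : ℝ} (h1 : ‖w‖ ≤ M) (h2 : ‖w⁻¹‖ ≤ M) :
    ‖Complex.log w‖ ≤ M + 4 := by
  refine (Complex.norm_le_abs_re_add_abs_im _).trans ?_
  rw [Complex.log_re, Complex.log_im]
  have h3 := Complex.abs_arg_le_pi w
  have h4 := Real.pi_lt_four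
  have hp : 0 < ‖w‖ := norm_pos_iff.2 hw
  have h5 : |Real.log ‖w‖| ≤ M := by
    rw [abs_le]
    constructor
    · have := Real.log_le_sub_one_of_pos (norm_pos_iff.2 (inv_ne_zero hw))
      rw [norm_inv, Real.log_inv] at this
      rw [norm_inv] at h2
      linarith
    · have := Real.log_le_sub_one_of_pos hp
      linarith
  linarith

open Metric in
lemma schottky_aux (ω : ℝ) : ∃ C : ℝ, ∀ (c : ℂ) (r : ℝ) (f : ℂ → ℂ), 0 < r →
    DifferentiableOn ℂ f (ball c r) → (∀ z ∈ ball c r, f z ≠ 0) → (∀ z ∈ ball c r, f z ≠ 1) →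
    1 / 2 ≤ ‖f c‖ → ‖f c‖ ≤ ω → ∀ z ∈ ball c (r / 2), ‖f z‖ ≤ C := by
  set A : ℝ := ω + 2 + 4 with hA
  set B : ℝ := 2 * A + 2 with hB
  set G : ℝ := B + 4 + 288 with hG
  refine ⟨Real.exp (8 * Real.exp G ^ 2), ?_⟩
  intro c r f hr hf hf0 hf1 hlo hhi
  have hc : c ∈ ball c r := mem_ball_self hr
  have hω : 1 / 2 ≤ ω := hlo.trans hhi
  -- F
  obtain ⟨l, hld, hl, hlc⟩ := exists_log_aux hr hf hf0
  have hpi : (2 * Real.pi * Complex.I : ℂ) ≠ 0 := Complex.two_pi_I_ne_zero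
  set F : ℂ → ℂ := fun z => l z / (2 * Real.pi * Complex.I) with hF
  have hFd : DifferentiableOn ℂ F (ball c r) := hld.div_const _
  have hFf : ∀ z ∈ ball c r, Complex.exp (2 * Real.pi * Complex.I * F z) = f z := by
    intro z hz
    rw [hF, mul_div_cancel₀ _ hpi, hl z hz]
  have hFk : ∀ z ∈ ball c r, ∀ k : ℤ, F z ≠ k := by
    intro z hz k hk
    apply hf1 z hz
    rw [← hFf z hz, hk, mul_comm]
    exact Complex.exp_int_mul_two_pi_mul_I k
  have hnpi : ‖(2 * Real.pi * Complex.I : ℂ)‖ = 2 * Real.pi := by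
    simp [abs_of_pos Real.pi_pos]
  have hFc : ‖F c‖ ≤ A := by
    have h1 : ‖l c‖ ≤ A := by
      rw [hlc]
      apply norm_log_aux (hf0 c hc)
      · linarith
      · rw [norm_inv]
        have : ‖f c‖⁻¹ ≤ (1 / 2)⁻¹ := by gcongr
        norm_num at this
        linarith
    rw [hF, norm_div, hnpi]
    refine (div_le_self (norm_nonneg _) ?_).trans h1
    linarith [Real.pi_gt_three]
  -- u, v
  obtain ⟨l0, hl0d, hl0, -⟩ := exists_log_aux hr hFd (fun z hz => by simpa using hFk z hz 0)
  obtain ⟨l1, hl1d, hl1, -⟩ := exists_log_aux hr (hFd.sub_const 1)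
    (fun z hz => by simpa [sub_eq_zero] using hFk z hz 1)
  set u : ℂ → ℂ := fun z => Complex.exp (l0 z / 2) with hu
  set v : ℂ → ℂ := fun z => Complex.exp (l1 z / 2) with hv
  have hu2 : ∀ z ∈ ball c r, u z ^ 2 = F z := by
    intro z hz
    rw [← hl0 z hz, hu, ← Complex.exp_nat_mul]
    congr 1; push_cast; ring
  have hv2 : ∀ z ∈ ball c r, v z ^ 2 = F z - 1 := by
    intro z hz
    rw [← hl1 z hz, hv, ← Complex.exp_nat_mul]
    congr 1; push_cast; ring
  have huv : ∀ z ∈ ball c r, (u z - v z) * (u z + v z) = 1 := by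
    intro z hz
    linear_combination hu2 z hz - hv2 z hz
  have huv0 : ∀ z ∈ ball c r, u z - v z ≠ 0 := by
    intro z hz h
    have := huv z hz
    rw [h, zero_mul] at this
    exact zero_ne_one this
  have hud : DifferentiableOn ℂ u (ball c r) := (hl0d.div_const 2).cexp
  have hvd : DifferentiableOn ℂ v (ball c r) := (hl1d.div_const 2).cexp
  obtain ⟨g, hgd, hg, hgc⟩ := exists_log_aux hr (hud.sub hvd) huv0
  have hcosh : ∀ z ∈ ball c r, Complex.cosh (g z) ^ 2 = F z := by
    intro z hz
    have h1 : Complex.exp (g z) = u z - v z := hg z hz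
    have h2 : Complex.exp (-g z) = u z + v z := by
      rw [Complex.exp_neg, h1]
      exact inv_eq_of_mul_eq_one_right (huv z hz)
    rw [Complex.cosh, h1, h2, ← hu2 z hz]
    ring
  -- bound of g c
  have huc : ‖u c‖ ≤ A + 1 := by
    have h1 := congrArg norm (hu2 c hc)
    rw [norm_pow] at h1
    nlinarith [norm_nonneg (u c)]
  have hvc : ‖v c‖ ≤ A + 1 := by
    have h1 := congrArg norm (hv2 c hc)
    rw [norm_pow] at h1
    have h2 := norm_sub_le (F c) 1
    rw [norm_one] at h2
    nlinarith [norm_nonneg (v c)]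
  have hgcb : ‖g c‖ ≤ B + 4 := by
    rw [hgc]
    apply norm_log_aux (huv0 c hc)
    · refine (norm_sub_le (u c) (v c)).trans ?_
      linarith
    · have : (u c - v c)⁻¹ = u c + v c :=
        inv_eq_of_mul_eq_one_right (huv c hc)
      rw [this]
      refine (norm_add_le _ _).trans ?_
      linarith
  -- Bloch
  have hder : ∀ a ∈ ball c (r / 2), ‖deriv g a‖ ≤ 576 / r := by
    intro a ha
    have hsub : closedBall a (r / 4) ⊆ ball c r := by
      intro z hz
      have h1 : dist z a ≤ r / 4 := hz
      have h2 : dist a c < r / 2 := ha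
      have := dist_triangle z a c
      rw [mem_ball]; linarith
    have := bloch_aux (L := 3) (by positivity : 0 < r / 4) isOpen_ball hsub hgd (by norm_num) (by
      intro y hy
      obtain ⟨p, hp, k, hk⟩ := lattice_aux y
      obtain ⟨z, hz, hzp⟩ := hy (by rwa [mem_ball, dist_eq_norm] : p ∈ ball y 3)
      apply hFk z hz k
      rw [← hcosh z hz, hzp, hk])
    rw [le_div_iff₀ hr]
    linarith
  intro z hz
  have hsub2 : ball c (r / 2) ⊆ ball c r := ball_subset_ball (by linarith)
  have hgz : ‖g z‖ ≤ G := by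
    have h1 := (convex_ball c (r / 2)).norm_image_sub_le_of_norm_deriv_le (f := g) (C := 576 / r)
      (fun x hx => (hgd x (hsub2 hx)).differentiableAt (isOpen_ball.mem_nhds (hsub2 hx))) hder
      (mem_ball_self (by positivity)) hz
    have h2 : ‖z - c‖ ≤ r / 2 := by rw [← dist_eq_norm]; exact (mem_ball.1 hz).le
    have h3 : 576 / r * ‖z - c‖ ≤ 576 / r * (r / 2) := by gcongr
    have h4 : 576 / r * (r / 2) = 288 := by field_simp; norm_num
    have h5 := norm_le_norm_add_norm_sub' (g z) (g c)
    linarith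
  have hz' := hsub2 hz
  have hch : ‖Complex.cosh (g z)‖ ≤ Real.exp G := by
    rw [Complex.cosh, norm_div]
    have h1 := (Complex.norm_exp_le_exp_norm (g z)).trans (Real.exp_le_exp.2 hgz)
    have h2 := (Complex.norm_exp_le_exp_norm (-g z)).trans
      (Real.exp_le_exp.2 ((norm_neg (g z)).le.trans hgz))
    have h3 := norm_add_le (Complex.exp (g z)) (Complex.exp (-g z))
    have h4 : ‖(2 : ℂ)‖ = 2 := by simp
    rw [h4]
    linarith
  have hFz : ‖F z‖ ≤ Real.exp G ^ 2 := by
    rw [← hcosh z hz', norm_pow]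
    gcongr
  rw [← hFf z hz']
  refine (Complex.norm_exp_le_exp_norm _).trans (Real.exp_le_exp.2 ?_)
  rw [norm_mul, hnpi]
  have := Real.pi_lt_four
  gcongr
  linarith

open Metric in
lemma schottky (ω : ℝ) : ∃ C : ℝ, ∀ (c : ℂ) (r : ℝ) (f : ℂ → ℂ), 0 < r →
    DifferentiableOn ℂ f (ball c r) → (∀ z ∈ ball c r, f z ≠ 0) → (∀ z ∈ ball c r, f z ≠ 1) →
    ‖f c‖ ≤ ω → ∀ z ∈ ball c (r / 2), ‖f z‖ ≤ C := by
  obtain ⟨C, hC⟩ := schottky_aux (ω + 1)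
  refine ⟨C + 1, fun c r f hr hf h0 h1 hω z hz => ?_⟩
  by_cases h : 1 / 2 ≤ ‖f c‖
  · have := hC c r f hr hf h0 h1 h (by linarith) z hz
    linarith
  · push Not at h
    have h2 := norm_sub_norm_le 1 (f c)
    have h3 := norm_sub_le 1 (f c)
    rw [norm_one] at h2 h3
    have := hC c r (fun z => 1 - f z) hr (hf.const_sub 1)
      (fun z hz h => h1 z hz (sub_eq_zero.1 h).symm)
      (fun z hz h => h0 z hz (by simpa using h)) (by linarith) (by linarith) z hz
    have h4 := norm_sub_le 1 (1 - f z)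
    rw [norm_one, sub_sub_cancel] at h4
    linarith

open Metric in
lemma chain_aux (k : ℕ) : ∀ ω : ℝ, ∃ C : ℝ, ∀ (z₀ : ℂ) (ρ : ℝ) (f : ℂ → ℂ), 0 < ρ →
    DifferentiableOn ℂ f (ball z₀ (2 * ρ)) → (∀ z ∈ ball z₀ (2 * ρ), z ≠ z₀ → f z ≠ 0) →
    (∀ z ∈ ball z₀ (2 * ρ), f z ≠ 1) → ∀ t s : ℝ, |t - s| ≤ k / 4 →
    ‖f (circleMap z₀ ρ t)‖ ≤ ω → ‖f (circleMap z₀ ρ s)‖ ≤ C := by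
  induction k with
  | zero =>
    intro ω
    refine ⟨ω, fun z₀ ρ f _ _ _ _ t s hts h => ?_⟩
    have : t = s := by
      have h1 : |t - s| ≤ 0 := by simpa using hts
      exact sub_eq_zero.1 (abs_nonpos_iff.1 h1)
    rwa [← this]
  | succ k ih =>
    intro ω
    obtain ⟨C₁, hC₁⟩ := schottky ω
    obtain ⟨C, hC⟩ := ih C₁
    refine ⟨C, fun z₀ ρ f hρ hf h0 h1 t s hts h => ?_⟩
    have hk : (0 : ℝ) < k + 1 := by positivity
    push_cast at hts
    set m : ℝ := t + (s - t) / (k + 1) with hm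
    have hmt : |m - t| ≤ 1 / 4 := by
      have : m - t = (s - t) / (k + 1) := by rw [hm]; ring
      rw [this, abs_div, abs_of_pos hk, abs_sub_comm, div_le_iff₀ hk]
      linarith
    have hms : |m - s| ≤ k / 4 := by
      have : m - s = (t - s) * (k / (k + 1)) := by rw [hm]; field_simp; ring
      rw [this, abs_mul, abs_of_nonneg (by positivity : (0 : ℝ) ≤ k / (k + 1))]
      calc |t - s| * (k / (k + 1)) ≤ ((k + 1) / 4) * (k / (k + 1)) := by gcongr
        _ = k / 4 := by field_simp
    refine hC z₀ ρ f hρ hf h0 h1 m s hms ?_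
    have hdist : dist (circleMap z₀ ρ t) z₀ = ρ := by
      simp [circleMap, abs_of_pos hρ]
    have hsub : ball (circleMap z₀ ρ t) ρ ⊆ ball z₀ (2 * ρ) := by
      apply ball_subset_ball'
      rw [hdist]; linarith
    refine hC₁ (circleMap z₀ ρ t) ρ f hρ (hf.mono hsub) (fun z hz => h0 z (hsub hz) ?_)
      (fun z hz => h1 z (hsub hz)) h _ ?_
    · rintro rfl
      rw [mem_ball, dist_comm, hdist] at hz
      exact lt_irrefl _ hz
    · rw [mem_ball, dist_eq_norm]
      have e : circleMap z₀ ρ m - circleMap z₀ ρ t =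
          ρ * Complex.exp (t * Complex.I) * (Complex.exp (Complex.I * ((m - t : ℝ) : ℂ)) - 1) := by
        simp only [circleMap]
        rw [mul_sub, mul_assoc, ← Complex.exp_add, mul_one]
        have : t * Complex.I + Complex.I * ((m - t : ℝ) : ℂ) = m * Complex.I := by
          push_cast; ring
        rw [this]; ring
      rw [e, norm_mul, norm_mul, Complex.norm_exp_ofReal_mul_I, Complex.norm_real,
        Real.norm_of_nonneg hρ.le, mul_one]
      have := Real.norm_exp_I_mul_ofReal_sub_one_le (x := m - t)
      rw [Real.norm_eq_abs] at this
      nlinarith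

open Metric in
lemma circle_aux (ω : ℝ) : ∃ C : ℝ, ∀ (z₀ : ℂ) (ρ : ℝ) (f : ℂ → ℂ), 0 < ρ →
    DifferentiableOn ℂ f (ball z₀ (2 * ρ)) → (∀ z ∈ ball z₀ (2 * ρ), z ≠ z₀ → f z ≠ 0) →
    (∀ z ∈ ball z₀ (2 * ρ), f z ≠ 1) → ∀ x ∈ sphere z₀ ρ, ‖f x‖ ≤ ω →
    ∀ y ∈ sphere z₀ ρ, ‖f y‖ ≤ C := by
  obtain ⟨C, hC⟩ := chain_aux 32 ω
  refine ⟨C, fun z₀ ρ f hρ hf h0 h1 x hx hfx y hy => ?_⟩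
  rw [← abs_of_pos hρ, ← image_circleMap_Ioc] at hx hy
  obtain ⟨t, ht, rfl⟩ := hx
  obtain ⟨s, hs, rfl⟩ := hy
  refine hC z₀ ρ f hρ hf h0 h1 t s ?_ hfx
  have := Real.pi_lt_four
  rw [abs_le]
  constructor <;> norm_num <;> linarith [ht.1, ht.2, hs.1, hs.2]

open Metric in
lemma montel_aux {z₀ : ℂ} {ρ M : ℝ} (hρ : 0 < ρ) (f : ℕ → ℂ → ℂ)
    (hf : ∀ n, DifferentiableOn ℂ (f n) (ball z₀ (2 * ρ)))
    (hM : ∀ n, ∀ z ∈ closedBall z₀ ρ, ‖f n z‖ ≤ M) :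
    ∃ φ : ℕ → ℕ, StrictMono φ ∧ ∃ g : ℂ → ℂ, DifferentiableOn ℂ g (ball z₀ (ρ / 2)) ∧
      TendstoLocallyUniformlyOn (fun n => f (φ n)) g atTop (ball z₀ (ρ / 2)) := by
  have hsub : closedBall z₀ (ρ / 2) ⊆ ball z₀ (2 * ρ) := closedBall_subset_ball (by linarith)
  have hM0 : 0 ≤ M := (norm_nonneg _).trans (hM 0 z₀ (mem_closedBall_self hρ.le))
  set K : ℝ := M / (ρ / 2) with hK
  have hK0 : 0 ≤ K := by positivity
  have hlip : ∀ n, ∀ x ∈ closedBall z₀ (ρ / 2), ∀ y ∈ closedBall z₀ (ρ / 2),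
      ‖f n y - f n x‖ ≤ K * ‖y - x‖ := by
    intro n x hx y hy
    refine (convex_closedBall z₀ (ρ / 2)).norm_image_sub_le_of_norm_deriv_le
      (fun x hx => (hf n x (hsub hx)).differentiableAt (isOpen_ball.mem_nhds (hsub hx)))
      (fun x hx => ?_) hx hy
    have hxs : closedBall x (ρ / 2) ⊆ closedBall z₀ ρ := by
      apply closedBall_subset_closedBall'
      have : dist x z₀ ≤ ρ / 2 := hx
      linarith
    have hxs2 : closedBall x (ρ / 2) ⊆ ball z₀ (2 * ρ) :=
      hxs.trans (closedBall_subset_ball (by linarith))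
    exact Complex.norm_deriv_le_of_forall_mem_sphere_norm_le (by positivity)
      (((hf n).mono hxs2).diffContOnCl_ball subset_rfl)
      (fun z hz => hM n z (hxs (sphere_subset_closedBall hz)))
  let S := closedBall z₀ (ρ / 2)
  haveI : CompactSpace S := isCompact_iff_compactSpace.1 (isCompact_closedBall z₀ (ρ / 2))
  let F : ℕ → BoundedContinuousFunction S ℂ := fun n =>
    BoundedContinuousFunction.mkOfCompact
      ⟨fun x => f n x, ((hf n).continuousOn.mono hsub).restrict⟩
  have hFa : ∀ n (x : S), F n x = f n x := fun n x => rfl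
  have hcpt : IsCompact (closure (range F)) := by
    refine BoundedContinuousFunction.arzela_ascoli (closedBall (0 : ℂ) M)
      (isCompact_closedBall _ _) _ ?_ ?_
    · rintro _ x ⟨n, rfl⟩
      rw [mem_closedBall_zero_iff, hFa]
      exact hM n x (closedBall_subset_closedBall (by linarith) x.2)
    · refine Metric.equicontinuous_of_continuity_modulus (fun t => K * t) ?_ _ ?_
      · have : Tendsto (fun t : ℝ => K * t) (𝓝 0) (𝓝 (K * 0)) := by
          apply Continuous.tendsto; fun_prop
        simpa using this
      · rintro x y ⟨_, n, rfl⟩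
        have := hlip n y y.2 x x.2
        simpa [dist_eq_norm, hFa, Subtype.dist_eq] using this
  obtain ⟨G, -, φ, hφ, hG⟩ := hcpt.tendsto_subseq (x := F) (fun n => subset_closure ⟨n, rfl⟩)
  classical
  let g : ℂ → ℂ := fun z => if hz : z ∈ S then G ⟨z, hz⟩ else 0
  have hu : TendstoUniformlyOn (fun n => f (φ n)) g atTop S := by
    rw [Metric.tendstoUniformlyOn_iff]
    intro ε hε
    filter_upwards [(Metric.tendsto_nhds.1 hG) ε hε] with n hn z hz
    have h1 : g z = G ⟨z, hz⟩ := dif_pos hz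
    rw [h1, dist_comm]
    exact (BoundedContinuousFunction.dist_coe_le_dist (f := F (φ n)) (g := G) ⟨z, hz⟩).trans_lt hn
  have hl : TendstoLocallyUniformlyOn (fun n => f (φ n)) g atTop (ball z₀ (ρ / 2)) :=
    (hu.mono ball_subset_closedBall).tendstoLocallyUniformlyOn
  refine ⟨φ, hφ, g, ?_, hl⟩
  exact hl.differentiableOn (Eventually.of_forall fun n =>
    (hf (φ n)).mono (ball_subset_closedBall.trans hsub)) isOpen_ball

open Metric in
lemma normal_aux {z₀ e w : ℂ} {ρ : ℝ} (hρ : 0 < ρ) (hew : w ≠ e) (f : ℕ → ℂ → ℂ)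
    (hf : ∀ n, DifferentiableOn ℂ (f n) (ball z₀ (2 * ρ)))
    (he : ∀ n, ∀ z ∈ ball z₀ (2 * ρ), z ≠ z₀ → f n z ≠ e)
    (hw : ∀ n, ∀ z ∈ ball z₀ (2 * ρ), f n z ≠ w) :
    ∃ φ : ℕ → ℕ, StrictMono φ ∧
      ((∃ g : ℂ → ℂ, DifferentiableOn ℂ g (ball z₀ (ρ / 2)) ∧
        TendstoLocallyUniformlyOn (fun n => f (φ n)) g atTop (ball z₀ (ρ / 2))) ∨
        TendstoLocallyUniformlyOnInfty (fun n => f (φ n)) (ball z₀ (ρ / 2))) := by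
  have hwe : w - e ≠ 0 := sub_ne_zero.2 hew
  have hwp : 0 < ‖w - e‖ := norm_pos_iff.2 hwe
  have hsub : closedBall z₀ ρ ⊆ ball z₀ (2 * ρ) := closedBall_subset_ball (by linarith)
  have hbc : closure (ball z₀ ρ) = closedBall z₀ ρ := closure_ball _ hρ.ne'
  have hfr : frontier (ball z₀ ρ) = sphere z₀ ρ := frontier_ball _ hρ.ne'
  by_cases hb : ∃ B : ℝ, ∃ᶠ n in atTop, ∃ x ∈ sphere z₀ ρ, ‖f n x‖ ≤ B
  · obtain ⟨B, hB⟩ := hb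
    obtain ⟨ψ, hψ, hψB⟩ := extraction_of_frequently_atTop hB
    obtain ⟨C, hC⟩ := circle_aux ((B + ‖e‖) / ‖w - e‖)
    have hbd : ∀ n, ∀ z ∈ closedBall z₀ ρ, ‖f (ψ n) z‖ ≤ C * ‖w - e‖ + ‖e‖ := by
      intro n z hz
      obtain ⟨x, hx, hxB⟩ := hψB n
      refine Complex.norm_le_of_forall_mem_frontier_norm_le isBounded_ball
        (((hf (ψ n)).mono hsub).diffContOnCl_ball subset_rfl) (fun y hy => ?_)
        (by rwa [hbc])
      rw [hfr] at hy
      have := hC z₀ ρ (fun z => (f (ψ n) z - e) / (w - e)) hρ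
        (((hf (ψ n)).sub_const e).div_const _)
        (fun z hz hne => div_ne_zero (sub_ne_zero.2 (he (ψ n) z hz hne)) hwe)
        (fun z hz h => hw (ψ n) z hz (by
          rw [div_eq_one_iff_eq hwe] at h
          exact sub_left_injective h)) x hx
        (by
          rw [norm_div]
          gcongr
          exact (norm_sub_le _ _).trans (by linarith)) y hy
      rw [norm_div, div_le_iff₀ hwp] at this
      have h2 := norm_le_norm_add_norm_sub' (f (ψ n) y) e
      linarith
    obtain ⟨φ, hφ, g, hg, hlim⟩ := montel_aux hρ (fun n => f (ψ n)) (fun n => hf (ψ n)) hbd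
    exact ⟨ψ ∘ φ, hψ.comp hφ, Or.inl ⟨g, hg, hlim⟩⟩
  · push Not at hb
    refine ⟨id, strictMono_id, Or.inr ?_⟩
    intro K hK _ M
    have hM1 : 0 < |M| + ‖w‖ + 1 := by positivity
    filter_upwards [hb (|M| + ‖w‖ + ‖w‖ + 1)] with n hn z hz
    have hne : ∀ z ∈ closedBall z₀ ρ, f n z - w ≠ 0 :=
      fun z hz => sub_ne_zero.2 (hw n z (hsub hz))
    have hzc : z ∈ closedBall z₀ ρ :=
      closedBall_subset_closedBall (by linarith) (ball_subset_closedBall (hK hz))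
    have key : ‖(f n z - w)⁻¹‖ ≤ (|M| + ‖w‖ + 1)⁻¹ := by
      refine Complex.norm_le_of_forall_mem_frontier_norm_le (f := fun z => (f n z - w)⁻¹)
        (U := ball z₀ ρ) isBounded_ball
        (DifferentiableOn.diffContOnCl_ball (U := closedBall z₀ ρ)
          ((((hf n).mono hsub).sub_const w).inv hne) subset_rfl) (fun y hy => ?_)
        (by rwa [hbc])
      rw [hfr] at hy
      rw [norm_inv]
      have h1 := hn y hy
      have h2 := norm_sub_norm_le (f n y) w
      gcongr
      linarith
    rw [norm_inv, inv_le_inv₀ (norm_pos_iff.2 (hne z hzc)) hM1] at key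
    have h3 := norm_sub_le (f n z) w
    have h4 := le_abs_self M
    simp only [id]
    linarith

/-- If `E(𝓕) ≠ ∅` and `N ⊆ D` is a neighborhood of a point of the Julia
like set `J(𝓕)`, then `ℂ \ ⋃_{f ∈ 𝓕} f(N) ⊆ E(𝓕)`. -/
theorem compl_image_nhd_subset_exceptional
    (D : Set ℂ) (hD : IsOpen D) (hDconn : IsConnected D)
    (𝓕 : Set (ℂ → ℂ)) (hol : ∀ f ∈ 𝓕, DifferentiableOn ℂ f D)
    (hE : (ExceptionalSet D 𝓕).Nonempty)
    (N : Set ℂ) (hND : N ⊆ D)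
    (z₀ : ℂ) (hz₀ : z₀ ∈ JuliaSet D 𝓕) (hN : N ∈ 𝓝 z₀) :
    Set.univ \ (⋃ f ∈ 𝓕, f '' N) ⊆ ExceptionalSet D 𝓕 := by
  rintro w ⟨-, hw⟩
  by_contra hwE
  obtain ⟨e, he⟩ := hE
  have hew : w ≠ e := by rintro rfl; exact hwE he
  have hw' : ∀ f ∈ 𝓕, ∀ z ∈ N, f z ≠ w := by
    intro f hf z hz h
    exact hw (mem_biUnion hf ⟨z, hz, h⟩)
  have hfin : (BackwardOrbit D 𝓕 e).Finite := he
  have hev : ∀ᶠ z in 𝓝 z₀, z ∈ N ∧ z ∉ BackwardOrbit D 𝓕 e \ {z₀} := by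
    refine Filter.Eventually.and hN ?_
    exact (hfin.subset diff_subset).isClosed.isOpen_compl.mem_nhds (by simp)
  obtain ⟨R, hR, hball⟩ := Metric.eventually_nhds_iff_ball.1 hev
  apply hz₀.2
  have hρ : 0 < R / 2 := by positivity
  have h2 : 2 * (R / 2) = R := by ring
  refine ⟨hz₀.1, Metric.ball z₀ (R / 2 / 2), ?_, Metric.ball_mem_nhds _ (by positivity), ?_⟩
  · intro z hz
    exact hND (hball z (Metric.ball_subset_ball (by linarith) hz)).1
  · intro f hf
    refine normal_aux hρ hew f ?_ ?_ ?_
    · rw [h2]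
      exact fun n => (hol _ (hf n)).mono fun z hz => hND (hball z hz).1
    · rw [h2]
      intro n z hz hne h
      exact (hball z hz).2 ⟨⟨hND (hball z hz).1, f n, hf n, h⟩, hne⟩
    · rw [h2]
      exact fun n z hz => hw' _ (hf n) z (hball z hz).1
end

section
/- Let D ⊆ ℂ be a simply connected domain and let D₁ and D₂ be two disjoint nonempty open connected subsets of D such that ∂D₁ ⊆ ∂D₂, where ∂ denotes the boundary taken relative to D. Then ∂D₁ is connected. -/
open Filter Topology Set

theorem aux_const {X : Type*} [TopologicalSpace X] {S : Set X} (hS : IsPreconnected S)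
    (k : X → ℝ) (hk : Continuous k) (hz : ∀ x ∈ S, ((k x : ℝ) : AddCircle (2 : ℝ)) = 0)
    {x y : X} (hx : x ∈ closure S) (hy : y ∈ closure S) : k x = k y := by
  have hz' : ∀ x ∈ closure S, ((k x : ℝ) : AddCircle (2 : ℝ)) = 0 := by
    have hc : IsClosed {x | ((k x : ℝ) : AddCircle (2 : ℝ)) = 0} :=
      isClosed_eq ((AddCircle.continuous_mk' (2 : ℝ)).comp hk) continuous_const
    exact fun x hx => closure_minimal hz hc hx
  have hI : (k '' closure S).OrdConnected := (hS.closure.image k hk.continuousOn).ordConnected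
  by_contra hne
  wlog hlt : k x < k y generalizing x y
  · exact this hy hx (Ne.symm hne) (lt_of_le_of_ne (not_lt.1 hlt) (Ne.symm hne))
  have hmid : min ((k x + k y) / 2) (k x + 1) ∈ k '' closure S :=
    hI.out ⟨x, hx, rfl⟩ ⟨y, hy, rfl⟩ ⟨by apply le_min <;> linarith,
      (min_le_left _ _).trans (by linarith)⟩
  obtain ⟨z, hzS, hzk⟩ := hmid
  have h1 := hz' x hx
  have h2 := hz' z hzS
  rw [AddCircle.coe_eq_zero_iff] at h1 h2
  obtain ⟨m, hm⟩ := h1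
  obtain ⟨n, hn⟩ := h2
  simp only [zsmul_eq_mul] at hm hn
  have a1 : k x < k z := by rw [hzk]; apply lt_min <;> linarith
  have a2 : k z ≤ k x + 1 := by rw [hzk]; exact min_le_right _ _
  have b1 : (m : ℝ) < n := by linarith
  have b2 : (n : ℝ) < m + 1 := by linarith
  have b1' : m < n := by exact_mod_cast b1
  have b2' : n < m + 1 := by exact_mod_cast b2
  omega

theorem aux_main {X : Type*} [TopologicalSpace X] [SimplyConnectedSpace X]
    [LocallyPathConnectedSpace X] [NormalSpace X] {U V : Set X} (hUo : IsOpen U)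
    (hU : IsPreconnected U) (hV : IsPreconnected V) (hd : Disjoint U V)
    (hb : frontier U ⊆ closure V) : IsPreconnected (frontier U) := by
  classical
  rw [isPreconnected_closed_iff]
  rintro t t' ht ht' hsub ⟨a, haU, hat⟩ ⟨b, hbU, hbt⟩
  by_contra hemp
  obtain ⟨f, f0, f1, -⟩ := exists_continuous_zero_one_of_isClosed
    (isClosed_frontier.inter ht : IsClosed (frontier U ∩ t))
    (isClosed_frontier.inter ht' : IsClosed (frontier U ∩ t'))
    (Set.disjoint_left.2 fun x hx hx' => hemp ⟨x, hx.1, hx.2, hx'.2⟩)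
  let q : ℝ → AddCircle (2 : ℝ) := fun r => (r : AddCircle (2 : ℝ))
  have hq : Continuous q := AddCircle.continuous_mk' (2 : ℝ)
  have hg : Continuous fun x => if x ∈ U then q (f x) else q (-f x) := by
    refine Continuous.if (fun x hx => ?_) (hq.comp f.continuous) (hq.comp f.continuous.neg)
    have hx : x ∈ frontier U := hx
    rcases hsub hx with h | h
    · have : f x = 0 := f0 ⟨hx, h⟩
      simp [this]
    · have : f x = 1 := f1 ⟨hx, h⟩
      rw [this]
      refine (QuotientAddGroup.eq_iff_sub_mem).2 ?_
      exact AddSubgroup.mem_zmultiples_iff.2 ⟨1, by norm_num⟩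
  obtain ⟨e, he⟩ := QuotientAddGroup.mk_surjective (if a ∈ U then q (f a) else q (-f a))
  obtain ⟨h, ⟨-, hh⟩, -⟩ := (AddCircle.isCoveringMap_coe (2 : ℝ)).existsUnique_continuousMap_lifts
    ⟨_, hg⟩ a e he
  have hh' : ∀ x, q (h x) = if x ∈ U then q (f x) else q (-f x) := fun x => congrFun hh x
  have fa : f a = 0 := f0 ⟨haU, hat⟩
  have fb : f b = 1 := f1 ⟨hbU, hbt⟩
  have e1 := aux_const hU (fun x => h x - f x) (by fun_prop) (fun x hx => by
    have := hh' x
    rw [if_pos hx] at this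
    rw [AddCircle.coe_sub, sub_eq_zero]; exact this) (frontier_subset_closure haU)
    (frontier_subset_closure hbU)
  have e2 := aux_const hV (fun x => h x - -f x) (by fun_prop) (fun x hx => by
    have := hh' x
    rw [if_neg (Set.disjoint_right.1 hd hx)] at this
    rw [AddCircle.coe_sub, sub_eq_zero]; exact this) (hb haU) (hb hbU)
  simp only [fa, fb] at e1 e2
  linarith

/-- In a simply connected domain `D ⊆ ℂ`, if `D₁, D₂` are disjoint
nonempty open connected subsets of `D` with `∂D₁ ⊆ ∂D₂` (boundaries relative to `D`),
then `∂D₁` is connected. -/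
theorem relBoundary_connected_of_subset
    (D : Set ℂ) (hD : IsOpen D) (hDconn : IsConnected D)
    (hsc : SimplyConnectedSpace D)
    (D₁ D₂ : Set ℂ) (h1D : D₁ ⊆ D) (h2D : D₂ ⊆ D)
    (h1o : IsOpen D₁) (h2o : IsOpen D₂)
    (h1c : IsConnected D₁) (h2c : IsConnected D₂)
    (hdisj : Disjoint D₁ D₂)
    (hbd : relBoundary D D₁ ⊆ relBoundary D D₂) :
    IsPreconnected (relBoundary D D₁) := by
  have : LocallyPathConnectedSpace D := hD.locallyPathConnectedSpace
  have hf : ∀ A : Set ℂ, frontier ((↑) ⁻¹' A : Set D) = (↑) ⁻¹' frontier A := fun A =>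
    (hD.isOpenEmbedding_subtypeVal.isOpenMap.preimage_frontier_eq_frontier_preimage
      continuous_subtype_val A).symm
  have hp : ∀ A : Set ℂ, A ⊆ D → IsPreconnected A → IsPreconnected ((↑) ⁻¹' A : Set D) :=
    fun A hA hc => by
      rw [← Topology.IsInducing.subtypeVal.isPreconnected_image, Subtype.image_preimage_coe,
        inter_eq_right.2 hA]
      exact hc
  have key := aux_main (U := ((↑) ⁻¹' D₁ : Set D)) (V := ((↑) ⁻¹' D₂ : Set D))
    (h1o.preimage continuous_subtype_val) (hp _ h1D h1c.isPreconnected)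
    (hp _ h2D h2c.isPreconnected) (hdisj.preimage _) (fun x hx => by
      rw [hf] at hx
      have h2 : x ∈ frontier ((↑) ⁻¹' D₂ : Set D) := by
        rw [hf]; exact (hbd ⟨x.2, hx⟩).2
      exact frontier_subset_closure h2)
  rw [hf, ← Topology.IsInducing.subtypeVal.isPreconnected_image, Subtype.image_preimage_coe] at key
  exact key
end

section
/- Let D ⊆ ℂ be a simply connected domain and let K be a closed subset of D (closed in the subspace topology of D). Then K is connected if and only if for every connected component G of D \ K, the boundary ∂G of G relative to D is connected. -/
open Filter Topology Set

theorem aux_unicoherent {α : Type*} [TopologicalSpace α] [NormalSpace α] [SimplyConnectedSpace α]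
    [LocallyPathConnectedSpace α] {X Y : Set α} (hX : IsClosed X) (hY : IsClosed Y)
    (hXY : X ∪ Y = univ) (cX : IsPreconnected X) (cY : IsPreconnected Y) :
    IsPreconnected (X ∩ Y) := by
  classical
  rw [isPreconnected_closed_iff]
  intro t t' ht ht' hsub ⟨p, hp, hpt⟩ ⟨q, hq, hqt⟩
  by_contra hne
  rw [Set.not_nonempty_iff_eq_empty] at hne
  obtain ⟨u, hu0, hu1, -⟩ := exists_continuous_zero_one_of_isClosed
    ((hX.inter hY).inter ht) ((hX.inter hY).inter ht') (by
      rw [Set.disjoint_iff]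
      rintro z ⟨⟨h1, h2⟩, h3, h4⟩
      have : z ∈ X ∩ Y ∩ (t ∩ t') := ⟨h1, h2, h4⟩
      rw [hne] at this
      exact this)
  have hup : u p = 0 := hu0 ⟨hp, hpt⟩
  have huq : u q = 1 := hu1 ⟨hq, hqt⟩
  let f1 : α → AddCircle (1 : ℝ) := fun z => ((u z / 2 : ℝ) : AddCircle (1 : ℝ))
  let f2 : α → AddCircle (1 : ℝ) := fun z => ((-(u z / 2) : ℝ) : AddCircle (1 : ℝ))
  have hf1 : Continuous f1 := (AddCircle.continuous_mk' 1).comp (by fun_prop)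
  have hf2 : Continuous f2 := (AddCircle.continuous_mk' 1).comp (by fun_prop)
  have hag : ∀ z ∈ X ∩ Y, f1 z = f2 z := by
    intro z hz
    rcases hsub hz with h | h
    · have : u z = 0 := hu0 ⟨hz, h⟩
      simp [f1, f2, this]
    · have : u z = 1 := hu1 ⟨hz, h⟩
      simp only [f1, f2, this]
      rw [← sub_eq_zero, ← AddCircle.coe_sub, AddCircle.coe_eq_zero_iff]
      exact ⟨1, by norm_num⟩
  let f : α → AddCircle (1 : ℝ) := fun z => if z ∈ X then f1 z else f2 z
  have hfX : EqOn f f1 X := fun z hz => if_pos hz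
  have hfY : EqOn f f2 Y := by
    intro z hz
    by_cases h : z ∈ X
    · rw [hfX h, hag z ⟨h, hz⟩]
    · exact if_neg h
  have hf : Continuous f := by
    rw [← continuousOn_univ, ← hXY]
    exact (hf1.continuousOn.congr hfX).union_of_isClosed (hf2.continuousOn.congr hfY) hX hY
  obtain ⟨e₀, he₀⟩ := QuotientAddGroup.mk_surjective (f p)
  obtain ⟨F, ⟨-, hF⟩, -⟩ := (AddCircle.isCoveringMap_coe (1 : ℝ)).existsUnique_continuousMap_lifts
    ⟨f, hf⟩ p e₀ he₀
  have hF' : ∀ z, ((F z : ℝ) : AddCircle (1 : ℝ)) = f z := fun z => congrFun hF z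
  have key : ∀ (S : Set α) (v : α → ℝ), Continuous v → IsPreconnected S →
      (∀ z ∈ S, f z = ((v z : ℝ) : AddCircle (1 : ℝ))) → p ∈ S → q ∈ S →
      F p - v p = F q - v q := by
    intro S v hv hS h hp hq
    have hint : ∀ z ∈ S, F z - v z ∈ range ((↑) : ℤ → ℝ) := by
      intro z hz
      have h1 := (hF' z).trans (h z hz)
      rw [← sub_eq_zero, ← AddCircle.coe_sub, AddCircle.coe_eq_zero_iff] at h1
      obtain ⟨n, hn⟩ := h1
      exact ⟨n, by simpa using hn⟩
    have : DiscreteTopology (range ((↑) : ℤ → ℝ)) := by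
      exact (Int.isClosedEmbedding_coe_real.isEmbedding.toHomeomorph.symm.isEmbedding).discreteTopology
    exact hS.constant_of_mapsTo (T := range ((↑) : ℤ → ℝ)) (f := fun z => F z - v z)
      ⟨this⟩ (by fun_prop) hint hp hq
  have k1 := key X (fun z => u z / 2) (by fun_prop) cX (fun z hz => hfX hz) hp.1 hq.1
  have k2 := key Y (fun z => -(u z / 2)) (by fun_prop) cY (fun z hz => hfY hz) hp.2 hq.2
  simp only [hup, huq] at k1 k2
  linarith

theorem aux_frontier_subset {α : Type*} [TopologicalSpace α] [LocallyConnectedSpace α]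
    {K : Set α} (hK : IsClosed K) (x : α) : frontier (connectedComponentIn Kᶜ x) ⊆ K := by
  intro y hy
  by_contra hyK
  have ho : IsOpen (connectedComponentIn Kᶜ x) := hK.isOpen_compl.connectedComponentIn
  have ho' : IsOpen (connectedComponentIn Kᶜ y) := hK.isOpen_compl.connectedComponentIn
  have hyy : y ∈ connectedComponentIn Kᶜ y := mem_connectedComponentIn hyK
  rw [ho.frontier_eq] at hy
  obtain ⟨z, hz1, hz2⟩ := mem_closure_iff.1 hy.1 _ ho' hyy
  have h1 := connectedComponentIn_eq hz1
  have h2 := connectedComponentIn_eq hz2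
  rw [h2, ← h1] at hy
  exact hy.2 hyy

theorem aux_frontier_nonempty {α : Type*} [TopologicalSpace α] [PreconnectedSpace α]
    {K : Set α} (hne : K.Nonempty) {x : α} (hx : x ∈ Kᶜ) :
    (frontier (connectedComponentIn Kᶜ x)).Nonempty := by
  rw [nonempty_frontier_iff]
  refine ⟨⟨x, mem_connectedComponentIn hx⟩, fun h => ?_⟩
  obtain ⟨k, hk⟩ := hne
  exact connectedComponentIn_subset Kᶜ x (h ▸ mem_univ k) hk

theorem aux_main_s8 {α : Type*} [TopologicalSpace α] [NormalSpace α] [SimplyConnectedSpace α]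
    [LocallyPathConnectedSpace α] {K : Set α} (hK : IsClosed K) :
    IsPreconnected K ↔ ∀ x ∈ Kᶜ, IsPreconnected (frontier (connectedComponentIn Kᶜ x)) := by
  have hop : ∀ x, IsOpen (connectedComponentIn Kᶜ x) :=
    fun x => hK.isOpen_compl.connectedComponentIn
  rcases K.eq_empty_or_nonempty with rfl | hne
  · refine ⟨fun _ x _ => ?_, fun _ => isPreconnected_empty⟩
    rw [subset_empty_iff.1 (aux_frontier_subset hK x)]
    exact isPreconnected_empty
  constructor
  · intro hc x hx
    set G := connectedComponentIn Kᶜ x with hG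
    have hfr : frontier G = closure G ∩ Gᶜ := (hop x).frontier_eq
    rw [hfr]
    have hKG : K ⊆ Gᶜ := fun k hk hkG => connectedComponentIn_subset Kᶜ x hkG hk
    refine aux_unicoherent isClosed_closure (hop x).isClosed_compl ?_
      isPreconnected_connectedComponentIn.closure ?_
    · rw [eq_univ_iff_forall]
      intro z
      by_cases hz : z ∈ G
      · exact Or.inl (subset_closure hz)
      · exact Or.inr hz
    · obtain ⟨k, hk⟩ := hne
      refine isPreconnected_of_forall k fun y hy => ?_
      by_cases hyK : y ∈ K
      · exact ⟨K, hKG, hk, hyK, hc⟩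
      refine ⟨K ∪ closure (connectedComponentIn Kᶜ y), ?_, Or.inl hk,
        Or.inr (subset_closure (mem_connectedComponentIn hyK)), ?_⟩
      · refine union_subset hKG fun z hz => ?_
        by_cases hzG : z ∈ connectedComponentIn Kᶜ y
        · intro hz'
          have h1 := connectedComponentIn_eq hzG
          have h2 := connectedComponentIn_eq hz'
          apply hy
          rw [hG, h2, ← h1]
          exact mem_connectedComponentIn hyK
        · exact hKG (aux_frontier_subset hK y (by
            rw [(hop y).frontier_eq]; exact ⟨hz, hzG⟩))
      · obtain ⟨w, hw⟩ := aux_frontier_nonempty ⟨k, hk⟩ (show y ∈ Kᶜ from hyK)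
        exact hc.union w (aux_frontier_subset hK y hw) (frontier_subset_closure hw)
          isPreconnected_connectedComponentIn.closure
  · intro h
    rw [isPreconnected_closed_iff]
    intro t t' ht ht' hsub ⟨p, hp, hpt⟩ ⟨q, hq, hqt⟩
    by_contra hcon
    rw [Set.not_nonempty_iff_eq_empty] at hcon
    have hdis : ∀ z ∈ K, z ∈ t → z ∉ t' := fun z h1 h2 h3 => by
      have : z ∈ K ∩ (t ∩ t') := ⟨h1, h2, h3⟩
      rw [hcon] at this
      exact this
    -- the hull of a closed piece `s`
    let W : Set α → Set α := fun s =>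
      {z | (z ∈ K ∧ z ∈ s) ∨ (z ∉ K ∧ frontier (connectedComponentIn Kᶜ z) ⊆ s)}
    have hopen : ∀ s s' : Set α, IsClosed s → IsClosed s' → K ⊆ s ∪ s' →
        (∀ z ∈ K, z ∈ s → z ∉ s') → IsOpen (W s) := by
      intro s s' hs hs' hss hd
      rw [isOpen_iff_mem_nhds]
      rintro z (⟨hzK, hzs⟩ | ⟨hzK, hzs⟩)
      · have hz' : z ∈ s'ᶜ := hd z hzK hzs
        have ho : IsOpen (connectedComponentIn s'ᶜ z) := hs'.isOpen_compl.connectedComponentIn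
        refine mem_of_superset (ho.mem_nhds (mem_connectedComponentIn hz')) fun y hy => ?_
        have hyC : y ∈ s'ᶜ := connectedComponentIn_subset _ _ hy
        by_cases hyK : y ∈ K
        · exact Or.inl ⟨hyK, (hss hyK).resolve_right hyC⟩
        refine Or.inr ⟨hyK, ?_⟩
        have hfK := aux_frontier_subset hK y
        -- the frontier meets the component
        have hm : ∃ w ∈ frontier (connectedComponentIn Kᶜ y), w ∈ s'ᶜ := by
          by_contra hno
          push Not at hno
          have hsubC : connectedComponentIn s'ᶜ z ⊆ connectedComponentIn Kᶜ y := by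
            refine isPreconnected_connectedComponentIn.subset_of_closure_inter_subset (hop y)
              ⟨y, hy, mem_connectedComponentIn hyK⟩ ?_
            rintro w ⟨hw1, hw2⟩
            by_contra hw3
            exact hno w (by rw [(hop y).frontier_eq]; exact ⟨hw1, hw3⟩)
              (connectedComponentIn_subset _ _ hw2)
          exact connectedComponentIn_subset _ _ (hsubC (mem_connectedComponentIn hz')) hzK
        obtain ⟨w, hw, hws⟩ := hm
        intro v hv
        by_contra hvs
        obtain ⟨a, ha, ha1, ha2⟩ := isPreconnected_closed_iff.1 (h y hyK) s s' hs hs'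
          (hfK.trans hss) ⟨w, hw, (hss (hfK hw)).resolve_right hws⟩
          ⟨v, hv, (hss (hfK hv)).resolve_left hvs⟩
        exact hd a (hfK ha) ha1 ha2
      · refine mem_of_superset ((hop z).mem_nhds (mem_connectedComponentIn hzK)) fun y hy => ?_
        refine Or.inr ⟨connectedComponentIn_subset _ _ hy, ?_⟩
        rw [← connectedComponentIn_eq hy]
        exact hzs
    have o1 := hopen t t' ht ht' hsub hdis
    have o2 := hopen t' t ht' ht (by rwa [union_comm]) (fun z h1 h2 h3 => hdis z h1 h3 h2)
    have hcov : (univ : Set α) ⊆ W t ∪ W t' := by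
      intro z _
      by_cases hzK : z ∈ K
      · rcases hsub hzK with h1 | h1
        · exact Or.inl (Or.inl ⟨hzK, h1⟩)
        · exact Or.inr (Or.inl ⟨hzK, h1⟩)
      have hfK := aux_frontier_subset hK z
      by_cases hft : frontier (connectedComponentIn Kᶜ z) ⊆ t
      · exact Or.inl (Or.inr ⟨hzK, hft⟩)
      by_cases hft' : frontier (connectedComponentIn Kᶜ z) ⊆ t'
      · exact Or.inr (Or.inr ⟨hzK, hft'⟩)
      exfalso
      obtain ⟨v, hv, hvt⟩ := not_subset.1 hft
      obtain ⟨w, hw, hwt⟩ := not_subset.1 hft'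
      obtain ⟨a, ha, ha1, ha2⟩ := isPreconnected_closed_iff.1 (h z hzK) t t' ht ht'
          (hfK.trans hsub) ⟨w, hw, (hsub (hfK hw)).resolve_right hwt⟩
          ⟨v, hv, (hsub (hfK hv)).resolve_left hvt⟩
      exact hdis a (hfK ha) ha1 ha2
    obtain ⟨z, -, hz1, hz2⟩ := isPreconnected_univ (W t) (W t') o1 o2 hcov
      ⟨p, mem_univ _, Or.inl ⟨hp, hpt⟩⟩ ⟨q, mem_univ _, Or.inl ⟨hq, hqt⟩⟩
    rcases hz1 with ⟨h1, h2⟩ | ⟨h1, h2⟩ <;> rcases hz2 with ⟨h3, h4⟩ | ⟨h3, h4⟩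
    · exact hdis z h1 h2 h4
    · exact h3 h1
    · exact h1 h3
    · obtain ⟨w, hw⟩ := aux_frontier_nonempty hne (show z ∈ Kᶜ from h1)
      exact hdis w (aux_frontier_subset hK z hw) (h2 hw) (h4 hw)

/-- Let `K` be a closed subset of a simply connected domain `D ⊆ ℂ`
(closed in the subspace topology of `D`). Then `K` is connected if and only if the boundary
(relative to `D`) of every connected component of `D \ K` is connected. -/
theorem closed_connected_iff_components_boundary_connected
    (D : Set ℂ) (hD : IsOpen D) (hDconn : IsConnected D)
    (hsc : SimplyConnectedSpace D)
    (K : Set ℂ) (hKD : K ⊆ D) (hKclosed : D ∩ closure K ⊆ K) :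
    IsPreconnected K ↔
      ∀ x ∈ D \ K, IsPreconnected (relBoundary D (connectedComponentIn (D \ K) x)) := by
  have hind : IsInducing (Subtype.val : D → ℂ) := IsInducing.subtypeVal
  have hom : IsOpenMap (Subtype.val : D → ℂ) := hD.isOpenMap_subtype_val
  have : LocallyPathConnectedSpace D := hD.locallyPathConnectedSpace
  let K' : Set D := Subtype.val ⁻¹' K
  have hK' : IsClosed K' := by
    rw [← closure_subset_iff_isClosed]
    intro z hz
    apply hKclosed
    refine ⟨z.2, ?_⟩
    have := continuous_subtype_val.closure_preimage_subset K hz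
    exact this
  have him : ∀ S : Set ℂ, S ⊆ D → (Subtype.val '' (Subtype.val ⁻¹' S : Set D)) = S := by
    intro S hS
    rw [Subtype.image_preimage_coe, inter_eq_right]
    exact hS
  have hpre : ∀ S : Set ℂ, S ⊆ D →
      (IsPreconnected (Subtype.val ⁻¹' S : Set D) ↔ IsPreconnected S) := by
    intro S hS
    rw [← hind.isPreconnected_image, him S hS]
  have hcomp : ∀ x : D, connectedComponentIn K'ᶜ x =
      Subtype.val ⁻¹' (connectedComponentIn (D \ K) x) := by
    intro x
    by_cases hx : (x : ℂ) ∈ K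
    · rw [connectedComponentIn_eq_empty (show x ∉ K'ᶜ from fun h => h hx),
        connectedComponentIn_eq_empty (fun h => h.2 hx), preimage_empty]
    apply Subset.antisymm
    · rw [← image_subset_iff]
      refine (isPreconnected_connectedComponentIn.image _
        continuous_subtype_val.continuousOn).subset_connectedComponentIn
        ⟨x, mem_connectedComponentIn hx, rfl⟩ ?_
      rintro _ ⟨y, hy, rfl⟩
      exact ⟨y.2, connectedComponentIn_subset _ _ hy⟩
    · refine IsPreconnected.subset_connectedComponentIn ?_ ?_ ?_
      · rw [hpre _ ((connectedComponentIn_subset _ _).trans sdiff_subset)]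
        exact isPreconnected_connectedComponentIn
      · exact mem_connectedComponentIn ⟨x.2, hx⟩
      · intro y hy
        exact (connectedComponentIn_subset _ _ hy).2
  rw [← hpre K hKD]
  refine (aux_main_s8 hK').trans ?_
  have hfr : ∀ x : D, IsPreconnected (frontier (connectedComponentIn K'ᶜ x)) ↔
      IsPreconnected (relBoundary D (connectedComponentIn (D \ K) x)) := by
    intro x
    rw [hcomp, ← hpre _ (show relBoundary D (connectedComponentIn (D \ K) x) ⊆ D from
      inter_subset_left), ← hom.preimage_frontier_eq_frontier_preimage continuous_subtype_val]
    simp [relBoundary]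
  constructor
  · intro h x hx
    exact (hfr ⟨x, hx.1⟩).1 (h ⟨x, hx.1⟩ hx.2)
  · intro h x hx
    exact (hfr x).2 (h x ⟨x.2, hx⟩)
end
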